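/- arXiv:2410.22920 — 3 statements merged into one kernel-verified Lean document; each statement's English description precedes it below -/
import Mathlib

section
/- Estimate for the far part of the velocity operator: for every integer K ≥ 1, every ε ∈ (0,1) and every J ∈ ℕ there exists a constant C > 0, depending only on K, ε, J and g, such that for all N ≥ 1, all a, b, Θ₀ ∈ ℝ with a² + b² = 1, and every f ∈ C^{K+J}(ℝ²) with supp f ⊂ B₁(0), setting w(x) = f(x)·sin(N(b x₁ + a x₂) + Θ₀), one has ‖V^far(w)‖_{C^J} ≤ C Σ_{i=0}^{K} N^{iε + J − K} ‖f‖_{C^{K−i+J}}. In particular, for J = 0, |V^far(w)(x)| ≤ C Σ_{i=0}^{K} N^{iε − K} ‖f‖_{C^{K−i}} for every x ∈ ℝ². -/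
open MeasureTheory Real Filter

/-- First spatial partial derivative `∂/∂x₁`. -/
noncomputable def pd1 (f : ℝ × ℝ → ℝ) : ℝ × ℝ → ℝ := fun x => fderiv ℝ f x (1, 0)

/-- Second spatial partial derivative `∂/∂x₂`. -/
noncomputable def pd2 (f : ℝ × ℝ → ℝ) : ℝ × ℝ → ℝ := fun x => fderiv ℝ f x (0, 1)

/-- Mixed partial derivative `∂₁^i ∂₂^j f`. -/
noncomputable def pdMix (i j : ℕ) (f : ℝ × ℝ → ℝ) : ℝ × ℝ → ℝ := pd1^[i] (pd2^[j] f)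

/-- The `C^k` norm: supremum of the absolute values of all partial derivatives
of order at most `k`. -/
noncomputable def CkNorm (k : ℕ) (f : ℝ × ℝ → ℝ) : ℝ :=
  sSup {y : ℝ | ∃ i j : ℕ, ∃ x : ℝ × ℝ, i + j ≤ k ∧ y = |pdMix i j f x|}

/-- The Euclidean norm `|h|` of `h ∈ ℝ²`. -/
noncomputable def rad (h : ℝ × ℝ) : ℝ := Real.sqrt (h.1 ^ 2 + h.2 ^ 2)

/-- A smooth radial cutoff: `C^∞`, nonincreasing on `[0,∞)`, equal to `1` on `(-∞,1/2]`
and to `0` on `[1,∞)`. -/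
def IsCutoff (g : ℝ → ℝ) : Prop :=
  ContDiff ℝ (⊤ : ℕ∞) g ∧ AntitoneOn g (Set.Ici 0) ∧
    (∀ r : ℝ, r ≤ 1 / 2 → g r = 1) ∧ (∀ r : ℝ, 1 ≤ r → g r = 0)

namespace VFar

/-- The derivative of `f` in the direction `e`. -/
noncomputable def dirDeriv (e : ℝ × ℝ) (f : ℝ × ℝ → ℝ) : ℝ × ℝ → ℝ := fun x => fderiv ℝ f x e

theorem contDiff_dirDeriv {e : ℝ × ℝ} {f : ℝ × ℝ → ℝ} {n : ℕ} (hf : ContDiff ℝ (n + 1 : ℕ) f) :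
    ContDiff ℝ n (dirDeriv e f) :=
  (hf.fderiv_right (by norm_cast)).clm_apply contDiff_const

theorem tsupport_dirDeriv_subset {e : ℝ × ℝ} {f : ℝ × ℝ → ℝ} {s : Set (ℝ × ℝ)}
    (hf : tsupport f ⊆ s) : tsupport (dirDeriv e f) ⊆ s :=
  (tsupport_fderiv_apply_subset ℝ e).trans hf

theorem dirDeriv_comm {e e' : ℝ × ℝ} {f : ℝ × ℝ → ℝ} (hf : ContDiff ℝ 2 f) :
    dirDeriv e (dirDeriv e' f) = dirDeriv e' (dirDeriv e f) := by
  have hd : Differentiable ℝ (fderiv ℝ f) :=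
    (hf.fderiv_right (m := 1) (by norm_num)).differentiable one_ne_zero
  ext x
  have key : ∀ u v : ℝ × ℝ, dirDeriv u (dirDeriv v f) x = fderiv ℝ (fderiv ℝ f) x u v := by
    intro u v
    change fderiv ℝ (fun y => fderiv ℝ f y v) x u = _
    rw [fderiv_clm_apply (hd x) (differentiableAt_const v)]
    simp
  rw [key, key]
  exact second_derivative_symmetric
    (fun y => (hf.differentiable two_ne_zero y).hasFDerivAt) (hd x).hasFDerivAt e e'

theorem contDiff_iterate_dirDeriv {e : ℝ × ℝ} (i : ℕ) {n : ℕ} {f : ℝ × ℝ → ℝ}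
    (hf : ContDiff ℝ (n + i : ℕ) f) : ContDiff ℝ n ((dirDeriv e)^[i] f) := by
  induction i generalizing f with
  | zero => simpa using hf
  | succ i ih => exact ih (contDiff_dirDeriv hf)

theorem tsupport_iterate_dirDeriv_subset {e : ℝ × ℝ} (i : ℕ) {f : ℝ × ℝ → ℝ} {s : Set (ℝ × ℝ)}
    (hf : tsupport f ⊆ s) : tsupport ((dirDeriv e)^[i] f) ⊆ s := by
  induction i generalizing f with
  | zero => simpa using hf
  | succ i ih => exact ih (tsupport_dirDeriv_subset hf)

theorem iterate_dirDeriv_comm {e e' : ℝ × ℝ} (i : ℕ) {f : ℝ × ℝ → ℝ}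
    (hf : ContDiff ℝ (i + 1 : ℕ) f) :
    (dirDeriv e)^[i] (dirDeriv e' f) = dirDeriv e' ((dirDeriv e)^[i] f) := by
  induction i generalizing f with
  | zero => rfl
  | succ i ih =>
    rw [Function.iterate_succ_apply, Function.iterate_succ_apply,
      dirDeriv_comm (hf.of_le (by norm_cast; omega)), ih (contDiff_dirDeriv hf)]

theorem contDiff_pdMix (i j : ℕ) {n : ℕ} {f : ℝ × ℝ → ℝ} (hf : ContDiff ℝ (n + i + j : ℕ) f) :
    ContDiff ℝ n (pdMix i j f) :=
  contDiff_iterate_dirDeriv i (contDiff_iterate_dirDeriv j hf)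

theorem pdMix_pd1 (i j : ℕ) {f : ℝ × ℝ → ℝ} (hf : ContDiff ℝ (j + 1 : ℕ) f) :
    pdMix i j (pd1 f) = pdMix (i + 1) j f :=
  congrArg (pd1^[i]) (iterate_dirDeriv_comm (e := (0, 1)) (e' := (1, 0)) j hf)

theorem CkNorm_nonneg (k : ℕ) (f : ℝ × ℝ → ℝ) : 0 ≤ CkNorm k f :=
  Real.sSup_nonneg (by rintro _ ⟨i, j, x, -, rfl⟩; positivity)

theorem abs_pdMix_le_CkNorm {k i j : ℕ} {f : ℝ × ℝ → ℝ} (hf : ContDiff ℝ k f)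
    (hs : HasCompactSupport f) (hij : i + j ≤ k) (x : ℝ × ℝ) : |pdMix i j f x| ≤ CkNorm k f := by
  refine le_csSup ?_ ⟨i, j, x, hij, rfl⟩
  have hb : ∀ i j : ℕ, ∃ C : ℝ, i + j ≤ k → ∀ x, |pdMix i j f x| ≤ C := by
    intro i j
    by_cases h : i + j ≤ k
    · have hc : Continuous (pdMix i j f) :=
        (contDiff_pdMix (n := 0) i j (hf.of_le (by norm_cast; omega))).continuous
      have hcs : HasCompactSupport (pdMix i j f) :=
        hs.of_isClosed_subset (isClosed_tsupport _) <|
          tsupport_iterate_dirDeriv_subset i (tsupport_iterate_dirDeriv_subset j subset_rfl)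
      obtain ⟨C, hC⟩ := hcs.exists_bound_of_continuous hc
      exact ⟨C, fun _ => hC⟩
    · exact ⟨0, fun h' => absurd h' h⟩
  choose C hC using hb
  refine ⟨∑ i ∈ Finset.range (k + 1), ∑ j ∈ Finset.range (k + 1), |C i j|, ?_⟩
  rintro _ ⟨i, j, x, hij, rfl⟩
  calc |pdMix i j f x| ≤ |C i j| := (hC i j hij x).trans (le_abs_self _)
    _ ≤ ∑ j ∈ Finset.range (k + 1), |C i j| :=
        Finset.single_le_sum (f := fun j => |C i j|) (fun _ _ => abs_nonneg _)
          (Finset.mem_range.2 (by omega))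
    _ ≤ _ := Finset.single_le_sum (f := fun i => ∑ j ∈ Finset.range (k + 1), |C i j|)
          (fun _ _ => Finset.sum_nonneg fun _ _ => abs_nonneg _) (Finset.mem_range.2 (by omega))

theorem CkNorm_mono {k l : ℕ} (hkl : k ≤ l) {f : ℝ × ℝ → ℝ} (hf : ContDiff ℝ l f)
    (hs : HasCompactSupport f) : CkNorm k f ≤ CkNorm l f := by
  refine Real.sSup_le ?_ (CkNorm_nonneg _ _)
  rintro _ ⟨i, j, x, hij, rfl⟩
  exact abs_pdMix_le_CkNorm hf hs (hij.trans hkl) x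

theorem CkNorm_pd1_le {k : ℕ} {f : ℝ × ℝ → ℝ} (hf : ContDiff ℝ (k + 1 : ℕ) f)
    (hs : HasCompactSupport f) : CkNorm k (pd1 f) ≤ CkNorm (k + 1) f := by
  refine Real.sSup_le ?_ (CkNorm_nonneg _ _)
  rintro _ ⟨i, j, x, hij, rfl⟩
  rw [pdMix_pd1 i j (hf.of_le (by norm_cast; omega))]
  exact abs_pdMix_le_CkNorm hf hs (by omega) x

theorem CkNorm_pd2_le {k : ℕ} {f : ℝ × ℝ → ℝ} (hf : ContDiff ℝ (k + 1 : ℕ) f)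
    (hs : HasCompactSupport f) : CkNorm k (pd2 f) ≤ CkNorm (k + 1) f := by
  refine Real.sSup_le ?_ (CkNorm_nonneg _ _)
  rintro _ ⟨i, j, x, hij, rfl⟩
  exact abs_pdMix_le_CkNorm (i := i) (j := j + 1) hf hs (by omega) x

/-- The function `f` modulated by a plane wave. -/
noncomputable def osc (N a b θ : ℝ) (f : ℝ × ℝ → ℝ) : ℝ × ℝ → ℝ :=
  fun y => f y * Real.sin (N * (b * y.1 + a * y.2) + θ)

theorem contDiff_osc {N a b θ : ℝ} {n : ℕ} {f : ℝ × ℝ → ℝ} (hf : ContDiff ℝ n f) :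
    ContDiff ℝ n (osc N a b θ f) := by
  unfold osc; fun_prop

theorem hasCompactSupport_osc {N a b θ : ℝ} {f : ℝ × ℝ → ℝ} (hf : HasCompactSupport f) :
    HasCompactSupport (osc N a b θ f) :=
  hf.mul_right

theorem dirDeriv_osc {N a b θ : ℝ} (e : ℝ × ℝ) {f : ℝ × ℝ → ℝ} (hf : ContDiff ℝ 1 f) :
    dirDeriv e (osc N a b θ f) = osc N a b θ (dirDeriv e f) +
      (N * (b * e.1 + a * e.2)) • osc N a b (θ + π / 2) f := by
  ext x
  have h1 : HasFDerivAt f (fderiv ℝ f x) x := (hf.differentiable one_ne_zero x).hasFDerivAt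
  have h2 : HasFDerivAt (fun y : ℝ × ℝ => N * (b * y.1 + a * y.2) + θ)
      (N • (b • ContinuousLinearMap.fst ℝ ℝ ℝ + a • ContinuousLinearMap.snd ℝ ℝ ℝ)) x :=
    (((hasFDerivAt_fst.const_mul b).add (hasFDerivAt_snd.const_mul a)).const_mul N).add_const θ
  have h3 := (h1.mul h2.sin).fderiv
  have h4 : dirDeriv e (osc N a b θ f) x = _ := congrArg (fun L => L e) h3
  rw [h4]
  simp only [osc, dirDeriv, Pi.add_apply, Pi.smul_apply, _root_.add_apply,
    _root_.smul_apply, ContinuousLinearMap.coe_fst', ContinuousLinearMap.coe_snd',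
    smul_eq_mul, ← add_assoc, Real.sin_add_pi_div_two]
  ring

/-- The correlation `x ↦ ∫ k(h) w(x + h) dh`. -/
noncomputable def corr (k w : ℝ × ℝ → ℝ) : ℝ × ℝ → ℝ := fun x => ∫ h, k h * w (x + h)

theorem corr_eq_convolution (k w : ℝ × ℝ → ℝ) :
    corr k w = convolution (fun h => k (-h)) w (ContinuousLinearMap.mul ℝ ℝ) volume := by
  ext x
  rw [convolution_def, corr, ← integral_neg_eq_self]
  simp [sub_eq_add_neg]

theorem contDiff_corr {k w : ℝ × ℝ → ℝ} {n : ℕ} (hk : Continuous k) (hw : ContDiff ℝ n w)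
    (hs : HasCompactSupport w) : ContDiff ℝ n (corr k w) := by
  rw [corr_eq_convolution]
  exact hs.contDiff_convolution_right (n := n) _ (hk.comp continuous_neg).locallyIntegrable hw

theorem dirDeriv_corr {e : ℝ × ℝ} {k w : ℝ × ℝ → ℝ} (hk : Continuous k) (hw : ContDiff ℝ 1 w)
    (hs : HasCompactSupport w) : dirDeriv e (corr k w) = corr k (dirDeriv e w) := by
  ext x
  have hk' : LocallyIntegrable (fun h => k (-h)) :=
    (hk.comp continuous_neg).locallyIntegrable
  rw [corr_eq_convolution, corr_eq_convolution, dirDeriv,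
    (hs.hasFDerivAt_convolution_right _ hk' hw x).fderiv,
    convolution_precompR_apply _ hk' (hs.fderiv ℝ) (hw.continuous_fderiv one_ne_zero)]
  rfl

theorem integrable_corr {k w : ℝ × ℝ → ℝ} (hk : Continuous k) (hw : Continuous w)
    (hs : HasCompactSupport w) (x : ℝ × ℝ) : Integrable fun h => k h * w (x + h) :=
  (hk.mul (hw.comp (continuous_const_add x))).integrable_of_hasCompactSupport
    (hs.comp_homeomorph (Homeomorph.addLeft x)).mul_left

theorem corr_add_smul {k w₁ w₂ : ℝ × ℝ → ℝ} (hk : Continuous k) (hw₁ : Continuous w₁)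
    (hs₁ : HasCompactSupport w₁) (hw₂ : Continuous w₂) (hs₂ : HasCompactSupport w₂) (c : ℝ) :
    corr k (w₁ + c • w₂) = corr k w₁ + c • corr k w₂ := by
  ext x
  simp only [corr, Pi.add_apply, Pi.smul_apply, smul_eq_mul]
  rw [← integral_const_mul, ← integral_add (integrable_corr hk hw₁ hs₁ x)
    ((integrable_corr hk hw₂ hs₂ x).const_mul c)]
  congr with h
  ring

theorem corr_dirDeriv {e : ℝ × ℝ} {k w : ℝ × ℝ → ℝ} (hk : ContDiff ℝ 1 k) (hw : ContDiff ℝ 1 w)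
    (hs : HasCompactSupport w) : corr k (dirDeriv e w) = -corr (dirDeriv e k) w := by
  ext x
  have hk' : Continuous (dirDeriv e k) := (contDiff_dirDeriv (n := 0) hk).continuous
  have hw' : Continuous (dirDeriv e w) := (contDiff_dirDeriv (n := 0) hw).continuous
  have hs' : HasCompactSupport (dirDeriv e w) := hs.fderiv_apply ℝ e
  have hd : ∀ h, fderiv ℝ (fun h => w (x + h)) h e = dirDeriv e w (x + h) := fun h => by
    rw [fderiv_comp_add_left]; rfl
  have := integral_mul_fderiv_eq_neg_fderiv_mul_of_integrable (μ := volume) (f := k)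
    (g := fun h => w (x + h)) (v := e) (integrable_corr hk' hw.continuous hs x)
    (by simpa only [hd] using integrable_corr hk.continuous hw' hs' x)
    (integrable_corr hk.continuous hw.continuous hs x)
    (fun y _ => hk.differentiable one_ne_zero y)
    (fun y _ => (hw.differentiable one_ne_zero _).comp y (by fun_prop))
  simp only [hd] at this
  exact this

theorem integrable_indicator_norm_inv :
    Integrable fun h : ℝ × ℝ => (Set.Iic (1 : ℝ)).indicator (fun r => r⁻¹) ‖h‖ := by
  rw [integrable_fun_norm_addHaar volume (f := (Set.Iic (1 : ℝ)).indicator fun r => r⁻¹)]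
  have h1 : IntegrableOn ((Set.Ioc (0 : ℝ) 1).indicator fun _ => (1 : ℝ)) (Set.Ioi 0) :=
    (integrable_indicator_iff measurableSet_Ioc |>.2 <|
      integrableOn_const (by simp) (by simp)).integrableOn
  refine h1.congr_fun (fun y hy => ?_) measurableSet_Ioi
  have hy : 0 < y := hy
  by_cases hy1 : y ≤ 1 <;> simp [Set.indicator, hy, hy1, hy.ne']

/-- A uniform bound for the integral of `‖h‖⁻¹` over unit balls of the plane. -/
noncomputable def kerConst : ℝ :=
  (∫ h : ℝ × ℝ, (Set.Iic (1 : ℝ)).indicator (fun r => r⁻¹) ‖h‖) +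
    volume.real (Metric.closedBall (0 : ℝ × ℝ) 1)

theorem kerConst_nonneg : 0 ≤ kerConst := by
  refine add_nonneg (integral_nonneg fun h => ?_) measureReal_nonneg
  exact Set.indicator_apply_nonneg fun _ => by positivity

theorem abs_corr_le {k w : ℝ × ℝ → ℝ} {M F : ℝ} (hM : 0 ≤ M) (hk : ∀ h, |k h| ≤ M * ‖h‖⁻¹)
    (hw : ∀ y, |w y| ≤ F) (hs : tsupport w ⊆ Metric.closedBall 0 1) (x : ℝ × ℝ) :
    |corr k w x| ≤ kerConst * M * F := by
  have hF : 0 ≤ F := (abs_nonneg _).trans (hw 0)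
  have hball : MeasurableSet ((x + ·) ⁻¹' Metric.closedBall (0 : ℝ × ℝ) 1) :=
    measurableSet_closedBall.preimage (measurable_const_add x)
  have hvol : volume.real ((x + ·) ⁻¹' Metric.closedBall (0 : ℝ × ℝ) 1) =
      volume.real (Metric.closedBall (0 : ℝ × ℝ) 1) := by
    simp only [Measure.real, measure_preimage_add]
  have hfin : volume ((x + ·) ⁻¹' Metric.closedBall (0 : ℝ × ℝ) 1) ≠ ⊤ := by
    rw [measure_preimage_add]; exact measure_closedBall_lt_top.ne
  have hi : Integrable (((x + ·) ⁻¹' Metric.closedBall (0 : ℝ × ℝ) 1).indicator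
      fun _ => (1 : ℝ)) :=
    (integrable_indicator_iff hball).2 (integrableOn_const hfin)
  have hle := norm_integral_le_of_norm_le (f := fun h => k h * w (x + h))
    ((integrable_indicator_norm_inv.add hi).const_mul (M * F))
    (Eventually.of_forall fun h => ?_)
  · rw [integral_const_mul] at hle
    simp only [Pi.add_apply] at hle
    rw [integral_add integrable_indicator_norm_inv hi, integral_indicator hball] at hle
    simp only [integral_const, measureReal_restrict_apply_univ, hvol, smul_eq_mul, mul_one] at hle
    calc |corr k w x| ≤ M * F * kerConst := hle
      _ = kerConst * M * F := by ring
  · simp only [Pi.add_apply]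
    have hn : 0 ≤ (Set.Iic (1 : ℝ)).indicator (fun r => r⁻¹) ‖h‖ :=
      Set.indicator_apply_nonneg fun _ => by positivity
    by_cases hx : x + h ∈ Metric.closedBall (0 : ℝ × ℝ) 1
    · have h1 : ‖h‖⁻¹ ≤ (Set.Iic (1 : ℝ)).indicator (fun r => r⁻¹) ‖h‖ + 1 := by
        by_cases hh : ‖h‖ ≤ 1
        · simp [Set.indicator, hh]
        · linarith [inv_le_one_of_one_le₀ (not_le.1 hh).le]
      have h2 : ((x + ·) ⁻¹' Metric.closedBall (0 : ℝ × ℝ) 1).indicator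
          (fun _ => (1 : ℝ)) h = 1 := Set.indicator_of_mem (by exact hx) _
      rw [h2, norm_mul, Real.norm_eq_abs, Real.norm_eq_abs]
      calc |k h| * |w (x + h)| ≤ (M * ‖h‖⁻¹) * F := by gcongr; exacts [hk h, hw _]
        _ = M * F * ‖h‖⁻¹ := by ring
        _ ≤ _ := by gcongr
    · have h0 : w (x + h) = 0 := image_eq_zero_of_notMem_tsupport fun h' => hx (hs h')
      rw [h0, mul_zero, norm_zero]
      exact mul_nonneg (mul_nonneg hM hF)
        (add_nonneg hn (Set.indicator_apply_nonneg fun _ => zero_le_one))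

/-- The weighted sum `∑ R ^ i ‖f‖_{C^{n - i + m}}`. -/
noncomputable def ckSum (n m : ℕ) (R : ℝ) (f : ℝ × ℝ → ℝ) : ℝ :=
  ∑ i ∈ Finset.range (n + 1), R ^ i * CkNorm (n - i + m) f

theorem ckSum_nonneg (n m : ℕ) {R : ℝ} (hR : 0 ≤ R) (f : ℝ × ℝ → ℝ) : 0 ≤ ckSum n m R f :=
  Finset.sum_nonneg fun _ _ => mul_nonneg (pow_nonneg hR _) (CkNorm_nonneg _ _)

theorem ckSum_mono {n m l : ℕ} (hml : m ≤ l) {R : ℝ} (hR : 0 ≤ R) {f : ℝ × ℝ → ℝ}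
    (hf : ContDiff ℝ (n + l : ℕ) f) (hs : HasCompactSupport f) :
    ckSum n m R f ≤ ckSum n l R f := by
  refine Finset.sum_le_sum fun i hi => mul_le_mul_of_nonneg_left ?_ (pow_nonneg hR _)
  exact CkNorm_mono (by omega) (hf.of_le (by norm_cast; omega)) hs

theorem ckSum_pd1_le {n m : ℕ} {R : ℝ} (hR : 0 ≤ R) {f : ℝ × ℝ → ℝ}
    (hf : ContDiff ℝ (n + m + 1 : ℕ) f) (hs : HasCompactSupport f) :
    ckSum n m R (pd1 f) ≤ ckSum n (m + 1) R f := by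
  refine Finset.sum_le_sum fun i hi => mul_le_mul_of_nonneg_left ?_ (pow_nonneg hR _)
  exact CkNorm_pd1_le (hf.of_le (by norm_cast; omega)) hs

theorem ckSum_pd2_le {n m : ℕ} {R : ℝ} (hR : 0 ≤ R) {f : ℝ × ℝ → ℝ}
    (hf : ContDiff ℝ (n + m + 1 : ℕ) f) (hs : HasCompactSupport f) :
    ckSum n m R (pd2 f) ≤ ckSum n (m + 1) R f := by
  refine Finset.sum_le_sum fun i hi => mul_le_mul_of_nonneg_left ?_ (pow_nonneg hR _)
  exact CkNorm_pd2_le (hf.of_le (by norm_cast; omega)) hs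

theorem ckSum_succ_le {n m : ℕ} {R : ℝ} (hR : 0 ≤ R) (f : ℝ × ℝ → ℝ) :
    ckSum n (m + 1) R f ≤ ckSum (n + 1) m R f := by
  rw [ckSum, ckSum, Finset.sum_range_succ _ (n + 1)]
  refine le_add_of_le_of_nonneg (Finset.sum_le_sum fun i hi => le_of_eq ?_)
    (mul_nonneg (pow_nonneg hR _) (CkNorm_nonneg _ _))
  rw [Finset.mem_range] at hi
  congr 2
  omega

theorem mul_ckSum_le {n m : ℕ} {R : ℝ} (f : ℝ × ℝ → ℝ) :
    R * ckSum n m R f ≤ ckSum (n + 1) m R f := by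
  rw [ckSum, ckSum, Finset.sum_range_succ' _ (n + 1), Finset.mul_sum]
  refine le_add_of_le_of_nonneg (Finset.sum_le_sum fun i _ => le_of_eq ?_)
    (by simpa using CkNorm_nonneg _ _)
  rw [Nat.succ_sub_succ]
  ring

theorem hasCompactSupport_of_tsupport_subset {f : ℝ × ℝ → ℝ}
    (hs : tsupport f ⊆ Metric.closedBall 0 1) : HasCompactSupport f :=
  (isCompact_closedBall 0 1).of_isClosed_subset (isClosed_tsupport f) hs

theorem corr_osc_dirDeriv_add {N a b θ : ℝ} (e : ℝ × ℝ) {k f : ℝ × ℝ → ℝ} (hk : Continuous k)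
    (hf : ContDiff ℝ 1 f) (hs : HasCompactSupport f) :
    corr k (dirDeriv e (osc N a b θ f)) = corr k (osc N a b θ (dirDeriv e f)) +
      (N * (b * e.1 + a * e.2)) • corr k (osc N a b (θ + π / 2) f) := by
  have hf' : ContDiff ℝ (0 : ℕ) (dirDeriv e f) := contDiff_dirDeriv hf
  rw [dirDeriv_osc e hf, corr_add_smul hk (contDiff_osc hf').continuous
    (hasCompactSupport_osc (hs.fderiv_apply ℝ e))
    (contDiff_osc (n := 0) (hf.of_le (by norm_num))).continuous (hasCompactSupport_osc hs)]

theorem abs_mul_corr_osc_le {N a b θ : ℝ} (e : ℝ × ℝ) {k f : ℝ × ℝ → ℝ} (hk : ContDiff ℝ 1 k)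
    (hf : ContDiff ℝ 1 f) (hs : HasCompactSupport f) (x : ℝ × ℝ) :
    |N * (b * e.1 + a * e.2)| * |corr k (osc N a b θ f) x| ≤
      |corr (dirDeriv e k) (osc N a b (θ - π / 2) f) x| +
        |corr k (osc N a b (θ - π / 2) (dirDeriv e f)) x| := by
  have h1 := corr_osc_dirDeriv_add (N := N) (a := a) (b := b) (θ := θ - π / 2) e
    hk.continuous hf hs
  rw [corr_dirDeriv hk (contDiff_osc (n := 1) hf) (hasCompactSupport_osc hs),
    sub_add_cancel] at h1
  have h2 := congrFun h1 x
  simp only [Pi.neg_apply, Pi.add_apply, Pi.smul_apply, smul_eq_mul] at h2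
  rw [← abs_mul, ← sub_eq_of_eq_add' h2, ← abs_neg (corr (dirDeriv e k) _ x)]
  exact abs_sub _ _

theorem norm_iteratedFDeriv_dirDeriv_le {e : ℝ × ℝ} (he : ‖e‖ ≤ 1) {k : ℝ × ℝ → ℝ}
    (hk : ContDiff ℝ (⊤ : ℕ∞) k) (i : ℕ) (h : ℝ × ℝ) :
    ‖iteratedFDeriv ℝ i (dirDeriv e k) h‖ ≤ ‖iteratedFDeriv ℝ (i + 1) k h‖ := by
  rw [← norm_iteratedFDeriv_fderiv]
  have hk' : ContDiff ℝ (⊤ : ℕ∞) (fderiv ℝ k) := hk.fderiv_right (by norm_num)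
  refine (norm_iteratedFDeriv_clm_apply_const hk'.contDiffAt
    (by exact_mod_cast le_top)).trans ?_
  exact mul_le_of_le_one_left (norm_nonneg _) he

theorem pow_mul_abs_corr_osc_le {N a b R : ℝ} (hN : 0 ≤ N) (hab : a ^ 2 + b ^ 2 = 1) (hR : 0 ≤ R)
    (x : ℝ × ℝ) (n : ℕ) {M : ℝ} (hM : 0 ≤ M) {k f : ℝ × ℝ → ℝ} (θ : ℝ)
    (hk : ContDiff ℝ (⊤ : ℕ∞) k)
    (hkb : ∀ i ≤ n, ∀ h, ‖iteratedFDeriv ℝ i k h‖ ≤ M * R ^ i * ‖h‖⁻¹)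
    (hf : ContDiff ℝ n f) (hs : tsupport f ⊆ Metric.closedBall 0 1) :
    N ^ n * |corr k (osc N a b θ f) x| ≤ kerConst * M * 4 ^ n * ckSum n 0 R f := by
  induction n generalizing M k f θ with
  | zero =>
    have hc := hasCompactSupport_of_tsupport_subset hs
    have h1 := abs_corr_le (k := k) (w := osc N a b θ f) (F := CkNorm 0 f) hM
      (fun h => by simpa using hkb 0 le_rfl h)
      (fun y => ?_) ((closure_mono (Function.support_mul_subset_left _ _)).trans hs) x
    · simpa [ckSum] using h1
    · rw [osc, abs_mul]
      exact (mul_le_of_le_one_right (abs_nonneg _) (Real.abs_sin_le_one _)).trans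
        (abs_pdMix_le_CkNorm (i := 0) (j := 0) hf hc le_rfl y)
  | succ n ih =>
    have hc := hasCompactSupport_of_tsupport_subset hs
    have hf1 : ContDiff ℝ 1 f := hf.of_le (by norm_cast; omega)
    have hk1 : ContDiff ℝ 1 k := hk.of_le (by norm_cast)
    have hfn : ContDiff ℝ n f := hf.of_le (by norm_cast; omega)
    have hP : 0 ≤ kerConst * M * 4 ^ n :=
      mul_nonneg (mul_nonneg kerConst_nonneg hM) (by positivity)
    have step : ∀ e : ℝ × ℝ, ‖e‖ ≤ 1 → ckSum n 0 R (dirDeriv e f) ≤ ckSum n 1 R f →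
        N ^ n * (|N * (b * e.1 + a * e.2)| * |corr k (osc N a b θ f) x|) ≤
          2 * (kerConst * M * 4 ^ n * ckSum (n + 1) 0 R f) := by
      intro e he hsum
      have h1 := ih (M := M * R) (k := dirDeriv e k) (f := f) (mul_nonneg hM hR) (θ - π / 2)
        ((hk.fderiv_right (by norm_num)).clm_apply contDiff_const)
        (fun i hi h => (norm_iteratedFDeriv_dirDeriv_le he hk i h).trans <|
          (hkb (i + 1) (by omega) h).trans_eq (by ring)) hfn hs
      have h2 := ih hM (k := k) (f := dirDeriv e f) (θ - π / 2) hk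
        (fun i hi => hkb i (by omega)) (contDiff_dirDeriv hf) (tsupport_dirDeriv_subset hs)
      have h3 : kerConst * (M * R) * 4 ^ n * ckSum n 0 R f ≤
          kerConst * M * 4 ^ n * ckSum (n + 1) 0 R f := by
        calc _ = kerConst * M * 4 ^ n * (R * ckSum n 0 R f) := by ring
          _ ≤ _ := mul_le_mul_of_nonneg_left (mul_ckSum_le f) hP
      have h4 := mul_le_mul_of_nonneg_left (hsum.trans (ckSum_succ_le hR f)) hP
      have h5 := mul_le_mul_of_nonneg_left
        (abs_mul_corr_osc_le (N := N) (a := a) (b := b) (θ := θ) e hk1 hf1 hc x)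
        (pow_nonneg hN n)
      linarith
    have s1 := step (1, 0) (by simp) (ckSum_pd1_le hR (by simpa using hf) hc)
    have s2 := step (0, 1) (by simp) (ckSum_pd2_le hR (by simpa using hf) hc)
    simp only [mul_one, mul_zero, add_zero, zero_add, abs_mul, abs_of_nonneg hN] at s1 s2
    have hab' : 1 ≤ |b| + |a| := by
      nlinarith [sq_abs a, sq_abs b, abs_nonneg a, abs_nonneg b]
    calc N ^ (n + 1) * |corr k (osc N a b θ f) x|
        ≤ N ^ (n + 1) * |corr k (osc N a b θ f) x| * (|b| + |a|) :=
          le_mul_of_one_le_right (by positivity) hab'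
      _ ≤ kerConst * M * 4 ^ (n + 1) * ckSum (n + 1) 0 R f := by
          rw [pow_succ, pow_succ]; linarith

theorem iterate_dirDeriv_add_smul {e : ℝ × ℝ} (i : ℕ) {u v : ℝ × ℝ → ℝ} (hu : ContDiff ℝ i u)
    (hv : ContDiff ℝ i v) (c : ℝ) :
    (dirDeriv e)^[i] (u + c • v) = (dirDeriv e)^[i] u + c • (dirDeriv e)^[i] v := by
  induction i generalizing u v with
  | zero => rfl
  | succ i ih =>
    have h1 : ∀ {w : ℝ × ℝ → ℝ}, ContDiff ℝ (i + 1 : ℕ) w → Differentiable ℝ w := fun hw =>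
      hw.differentiable (by norm_cast)
    have h2 : dirDeriv e (u + c • v) = dirDeriv e u + c • dirDeriv e v := by
      ext x
      simp only [dirDeriv]
      rw [fderiv_add (h1 hu x) ((h1 hv x).const_smul c), fderiv_const_smul (h1 hv x)]
      rfl
    rw [Function.iterate_succ_apply, h2, ih (contDiff_dirDeriv hu) (contDiff_dirDeriv hv)]
    rfl

theorem pdMix_add_smul (i j : ℕ) {u v : ℝ × ℝ → ℝ} (hu : ContDiff ℝ (i + j : ℕ) u)
    (hv : ContDiff ℝ (i + j : ℕ) v) (c : ℝ) :
    pdMix i j (u + c • v) = pdMix i j u + c • pdMix i j v := by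
  have hj : ((j : ℕ) : WithTop ℕ∞) ≤ (i + j : ℕ) := by norm_cast; omega
  refine (congrArg (pd1^[i]) (iterate_dirDeriv_add_smul (e := (0, 1)) j (hu.of_le hj)
    (hv.of_le hj) c)).trans ?_
  exact iterate_dirDeriv_add_smul i (contDiff_iterate_dirDeriv j hu)
    (contDiff_iterate_dirDeriv j hv) c

theorem pow_mul_abs_pdMix_corr_osc_le {N a b R M : ℝ} (hN : 0 ≤ N) (hab : a ^ 2 + b ^ 2 = 1)
    (hR : 0 ≤ R) (hM : 0 ≤ M) {n : ℕ} {k : ℝ × ℝ → ℝ} (hk : ContDiff ℝ (⊤ : ℕ∞) k)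
    (hkb : ∀ i ≤ n, ∀ h, ‖iteratedFDeriv ℝ i k h‖ ≤ M * R ^ i * ‖h‖⁻¹) (hN1 : 1 ≤ N)
    (x : ℝ × ℝ) (m : ℕ) {i j : ℕ} (hij : i + j = m) (θ : ℝ) {f : ℝ × ℝ → ℝ}
    (hf : ContDiff ℝ (n + m : ℕ) f) (hs : tsupport f ⊆ Metric.closedBall 0 1) :
    N ^ n * |pdMix i j (corr k (osc N a b θ f)) x| ≤
      kerConst * M * 4 ^ n * ((2 * N) ^ m * ckSum n m R f) := by
  induction m generalizing i j θ f with
  | zero =>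
    obtain ⟨rfl, rfl⟩ : i = 0 ∧ j = 0 := by omega
    simpa [pdMix] using pow_mul_abs_corr_osc_le hN hab hR x n hM θ hk hkb hf hs
  | succ m ih =>
    have hc := hasCompactSupport_of_tsupport_subset hs
    have hf1 : ContDiff ℝ 1 f := hf.of_le (by norm_cast; omega)
    have hfm : ContDiff ℝ (n + m : ℕ) f := hf.of_le (by norm_cast; omega)
    have hP : 0 ≤ kerConst * M * 4 ^ n :=
      mul_nonneg (mul_nonneg kerConst_nonneg hM) (by positivity)
    have step : ∀ (e : ℝ × ℝ) (i j : ℕ), i + j = m → |b * e.1 + a * e.2| ≤ 1 →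
        ckSum n m R (dirDeriv e f) ≤ ckSum n (m + 1) R f →
        N ^ n * |pdMix i j (dirDeriv e (corr k (osc N a b θ f))) x| ≤
          kerConst * M * 4 ^ n * ((2 * N) ^ (m + 1) * ckSum n (m + 1) R f) := by
      intro e i j hij he hsum
      have hm : ((i + j : ℕ) : WithTop ℕ∞) ≤ (n + m : ℕ) := by norm_cast; omega
      have hf' : ContDiff ℝ (n + m : ℕ) (dirDeriv e f) := contDiff_dirDeriv hf
      rw [dirDeriv_corr hk.continuous (contDiff_osc (n := 1) hf1) (hasCompactSupport_osc hc),
        corr_osc_dirDeriv_add e hk.continuous hf1 hc, pdMix_add_smul i j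
          (contDiff_corr hk.continuous (contDiff_osc (hf'.of_le hm))
            (hasCompactSupport_osc (hc.fderiv_apply ℝ e)))
          (contDiff_corr hk.continuous (contDiff_osc (hfm.of_le hm)) (hasCompactSupport_osc hc)),
        Pi.add_apply, Pi.smul_apply, smul_eq_mul]
      have h1 := ih hij θ hf' (tsupport_dirDeriv_subset hs)
      have h2 := ih hij (θ + π / 2) hfm hs
      have hs1 : ckSum n m R f ≤ ckSum n (m + 1) R f := ckSum_mono (by omega) hR hf hc
      set p := pdMix i j (corr k (osc N a b θ (dirDeriv e f))) x
      set q := pdMix i j (corr k (osc N a b (θ + π / 2) f)) x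
      have h3 : |p + N * (b * e.1 + a * e.2) * q| ≤ |p| + N * |q| := by
        refine (abs_add_le _ _).trans (add_le_add_right ?_ _)
        rw [abs_mul, abs_mul, abs_of_nonneg hN]
        exact mul_le_mul_of_nonneg_right (mul_le_of_le_one_right hN he) (abs_nonneg _)
      set S := ckSum n (m + 1) R f
      have hS : 0 ≤ S := ckSum_nonneg _ _ hR _
      set P := kerConst * M * 4 ^ n
      have h4 : P * ((2 * N) ^ m * ckSum n m R (dirDeriv e f)) ≤ N * (P * ((2 * N) ^ m * S)) :=
        calc _ ≤ P * ((2 * N) ^ m * S) := by gcongr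
          _ ≤ _ := le_mul_of_one_le_left (by positivity) hN1
      have h5 : N * (P * ((2 * N) ^ m * ckSum n m R f)) ≤ N * (P * ((2 * N) ^ m * S)) := by gcongr
      calc N ^ n * |p + N * (b * e.1 + a * e.2) * q| ≤ N ^ n * (|p| + N * |q|) := by gcongr
        _ = N ^ n * |p| + N * (N ^ n * |q|) := by ring
        _ ≤ N * (P * ((2 * N) ^ m * S)) + N * (P * ((2 * N) ^ m * S)) :=
            add_le_add (h1.trans h4) ((mul_le_mul_of_nonneg_left h2 hN).trans h5)
        _ = _ := by ring
    rcases j with _ | j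
    · obtain rfl : i = m + 1 := by omega
      exact step (1, 0) m 0 rfl (by simpa using (sq_le_one_iff_abs_le_one b).1 (by nlinarith))
        (ckSum_pd1_le hR hf hc)
    · exact step (0, 1) i j (by omega)
        (by simpa using (sq_le_one_iff_abs_le_one a).1 (by nlinarith)) (ckSum_pd2_le hR hf hc)

/-- The truncated kernel at unit scale. -/
noncomputable def farKernel (g : ℝ → ℝ) : ℝ × ℝ → ℝ :=
  fun h => h.1 / (h.1 ^ 2 + h.2 ^ 2) * (1 - g (rad h))

theorem rad_smul {s : ℝ} (hs : 0 ≤ s) (h : ℝ × ℝ) : rad (s • h) = s * rad h := by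
  simp only [rad, Prod.smul_fst, Prod.smul_snd, smul_eq_mul]
  rw [show (s * h.1) ^ 2 + (s * h.2) ^ 2 = s ^ 2 * (h.1 ^ 2 + h.2 ^ 2) by ring,
    Real.sqrt_mul (sq_nonneg s), Real.sqrt_sq hs]

theorem continuous_rad : Continuous rad := by unfold rad; fun_prop

theorem norm_le_rad (h : ℝ × ℝ) : ‖h‖ ≤ rad h := by
  rw [Prod.norm_def]
  exact max_le (Real.abs_le_sqrt (by nlinarith [sq_nonneg h.2]))
    (Real.abs_le_sqrt (by nlinarith [sq_nonneg h.1]))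

theorem farKernel_eventuallyEq_zero {g : ℝ → ℝ} (hg : IsCutoff g) :
    farKernel g =ᶠ[nhds 0] fun _ => 0 := by
  have h0 : rad 0 < 1 / 2 := by simp [rad]
  filter_upwards [continuous_rad.continuousAt.eventually_lt continuousAt_const h0] with h hh
  rw [farKernel, hg.2.2.1 _ hh.le, sub_self, mul_zero]

theorem contDiff_farKernel {g : ℝ → ℝ} (hg : IsCutoff g) :
    ContDiff ℝ (⊤ : ℕ∞) (farKernel g) := by
  rw [contDiff_iff_contDiffAt]
  intro x
  by_cases hx : x = 0
  · rw [hx]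
    exact contDiffAt_const.congr_of_eventuallyEq (farKernel_eventuallyEq_zero hg)
  · have hne : x.1 ^ 2 + x.2 ^ 2 ≠ 0 := by
      intro h
      refine hx (Prod.ext ?_ ?_)
      · exact pow_eq_zero_iff two_ne_zero |>.1 (by nlinarith [sq_nonneg x.1, sq_nonneg x.2])
      · exact pow_eq_zero_iff two_ne_zero |>.1 (by nlinarith [sq_nonneg x.1, sq_nonneg x.2])
    have hsq : ContDiffAt ℝ (⊤ : ℕ∞) (fun h : ℝ × ℝ => h.1 ^ 2 + h.2 ^ 2) x := by fun_prop
    exact (contDiffAt_fst.div hsq hne).mul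
      (contDiffAt_const.sub (hg.1.contDiffAt.comp x (hsq.sqrt hne)))

theorem farKernel_smul {g : ℝ → ℝ} (hg : IsCutoff g) {s : ℝ} (hs : 1 ≤ s) {u : ℝ × ℝ}
    (hu : 1 ≤ rad u) : farKernel g (s • u) = s⁻¹ * farKernel g u := by
  have hs0 : 0 < s := zero_lt_one.trans_le hs
  simp only [farKernel]
  rw [rad_smul hs0.le, hg.2.2.2 _ hu, hg.2.2.2 _ (one_le_mul_of_one_le_of_one_le hs hu)]
  simp only [Prod.smul_fst, Prod.smul_snd, smul_eq_mul, mul_pow, ← mul_add, sub_zero, mul_one]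
  rw [sq s, mul_assoc, mul_div_mul_left _ _ hs0.ne', ← div_div, div_right_comm, div_eq_inv_mul]

theorem exists_norm_iteratedFDeriv_farKernel_le {g : ℝ → ℝ} (hg : IsCutoff g) (i : ℕ) :
    ∃ C, 0 ≤ C ∧ ∀ h, ‖iteratedFDeriv ℝ i (farKernel g) h‖ ≤ C * ‖h‖⁻¹ := by
  have hk := contDiff_farKernel hg
  have hki : ContDiff ℝ i (farKernel g) := hk.of_le (by exact_mod_cast le_top)
  obtain ⟨C, hC⟩ := (isCompact_closedBall (0 : ℝ × ℝ) 2).exists_bound_of_continuousOn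
    (hk.continuous_iteratedFDeriv (m := i) (by exact_mod_cast le_top)).continuousOn
  have hC0 : 0 ≤ C := (norm_nonneg _).trans (hC 0 (by simp))
  refine ⟨2 * C, by positivity, fun h => ?_⟩
  rcases eq_or_ne h 0 with rfl | hh
  · have h0 := ((farKernel_eventuallyEq_zero hg).iteratedFDeriv ℝ i).eq_of_nhds
    rw [h0]
    simp
  have hpos : 0 < ‖h‖ := norm_pos_iff.2 hh
  by_cases h2 : ‖h‖ ≤ 2
  · refine (hC h (by simpa using h2)).trans ?_
    rw [mul_comm 2 C, mul_assoc]
    refine le_mul_of_one_le_right hC0 ?_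
    rw [← div_eq_mul_inv, one_le_div hpos]
    exact h2
  · set s := ‖h‖ / 2 with hs
    have hs1 : 1 ≤ s := by rw [hs]; linarith
    have hs0 : 0 < s := zero_lt_one.trans_le hs1
    set u := s⁻¹ • h with hu
    have hsu : s • u = h := smul_inv_smul₀ hs0.ne' h
    have hun : ‖u‖ = 2 := by
      rw [hu, norm_smul, norm_inv, Real.norm_of_nonneg hs0.le, hs]
      field_simp
    have hev : (fun z => farKernel g (s • z)) =ᶠ[nhds u] s⁻¹ • farKernel g := by
      have hlt : (1 : ℝ) < rad u := by linarith [norm_le_rad u]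
      filter_upwards [continuousAt_const.eventually_lt continuous_rad.continuousAt hlt] with z hz
      exact farKernel_smul hg hs1 hz.le
    have h1 := (hev.iteratedFDeriv ℝ i).eq_of_nhds
    rw [iteratedFDeriv_comp_const_smul s hki, iteratedFDeriv_const_smul_apply hki.contDiffAt] at h1
    simp only [hsu] at h1
    have h3 := congrArg norm h1
    rw [norm_smul, norm_smul, norm_pow, norm_inv, Real.norm_of_nonneg hs0.le] at h3
    calc ‖iteratedFDeriv ℝ i (farKernel g) h‖
        ≤ s ^ i * ‖iteratedFDeriv ℝ i (farKernel g) h‖ :=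
          le_mul_of_one_le_left (norm_nonneg _) (one_le_pow₀ hs1)
      _ = s⁻¹ * ‖iteratedFDeriv ℝ i (farKernel g) u‖ := h3
      _ ≤ s⁻¹ * C := by gcongr; exact hC u (by simp [hun])
      _ = 2 * C * ‖h‖⁻¹ := by rw [hs]; field_simp

theorem exists_norm_iteratedFDeriv_scaled_farKernel_le {g : ℝ → ℝ} (hg : IsCutoff g) (n : ℕ) :
    ∃ M, 0 ≤ M ∧ ∀ R : ℝ, 0 < R → ∀ i ≤ n, ∀ h,
      ‖iteratedFDeriv ℝ i (fun z => R * farKernel g (R • z)) h‖ ≤ M * R ^ i * ‖h‖⁻¹ := by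
  choose C hC0 hC using exists_norm_iteratedFDeriv_farKernel_le hg
  refine ⟨∑ i ∈ Finset.range (n + 1), C i, Finset.sum_nonneg fun i _ => hC0 i, ?_⟩
  intro R hR i hi h
  have hki : ContDiff ℝ i (farKernel g) :=
    (contDiff_farKernel hg).of_le (by exact_mod_cast le_top)
  have hkR : ContDiff ℝ i (fun z => farKernel g (R • z)) :=
    hki.comp (contDiff_const_smul R)
  have h1 := iteratedFDeriv_const_smul_apply' (a := R) (hkR.contDiffAt (x := h))
  simp only [smul_eq_mul] at h1
  rw [h1, iteratedFDeriv_comp_const_smul R hki, norm_smul, norm_smul, norm_pow,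
    Real.norm_of_nonneg hR.le]
  have h2 := hC i (R • h)
  rw [norm_smul, mul_inv, Real.norm_of_nonneg hR.le] at h2
  calc R * (R ^ i * ‖iteratedFDeriv ℝ i (farKernel g) (R • h)‖)
      ≤ R * (R ^ i * (C i * (R⁻¹ * ‖h‖⁻¹))) := by gcongr
    _ = C i * R ^ i * ‖h‖⁻¹ := by field_simp
    _ ≤ _ := by
      gcongr
      exact Finset.single_le_sum (fun i _ => hC0 i) (Finset.mem_range.2 (by omega))

theorem scaled_farKernel_apply {g : ℝ → ℝ} {R : ℝ} (hR : 0 < R) (h : ℝ × ℝ) :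
    R * farKernel g (R • h) = h.1 / (h.1 ^ 2 + h.2 ^ 2) * (1 - g (R * rad h)) := by
  simp only [farKernel]
  rw [rad_smul hR.le]
  simp only [Prod.smul_fst, Prod.smul_snd, smul_eq_mul, mul_pow, ← mul_add]
  rw [← mul_assoc, mul_div_assoc', ← mul_assoc, ← sq, mul_div_mul_left _ _ (pow_pos hR 2).ne']

theorem tsupport_subset_closedBall {f : ℝ × ℝ → ℝ}
    (hf : ∀ x : ℝ × ℝ, f x ≠ 0 → x.1 ^ 2 + x.2 ^ 2 < 1) :
    tsupport f ⊆ Metric.closedBall 0 1 := by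
  refine closure_minimal (fun x hx => ?_) Metric.isClosed_closedBall
  rw [mem_closedBall_zero_iff]
  refine (norm_le_rad x).trans ?_
  exact Real.sqrt_le_one.2 (hf x hx).le

end VFar

/-- Estimate for the far part `V^far` of the velocity operator. -/
theorem vfar_estimate (g : ℝ → ℝ) (hg : IsCutoff g)
    (K : ℕ) (hK : 1 ≤ K) (ε : ℝ) (hε : ε ∈ Set.Ioo (0 : ℝ) 1) (J : ℕ) :
    ∃ C > 0, ∀ N : ℝ, 1 ≤ N → ∀ a b Θ₀ : ℝ, a ^ 2 + b ^ 2 = 1 →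
      ∀ f : ℝ × ℝ → ℝ, ContDiff ℝ (K + J : ℕ) f →
        (∀ x : ℝ × ℝ, f x ≠ 0 → x.1 ^ 2 + x.2 ^ 2 < 1) →
        CkNorm J (fun x : ℝ × ℝ =>
            ∫ h : ℝ × ℝ, (h.1 / (h.1 ^ 2 + h.2 ^ 2)) * f (x + h)
              * Real.sin (N * (b * (x.1 + h.1) + a * (x.2 + h.2)) + Θ₀)
              * (1 - g (N ^ ε * rad h)))
          ≤ C * ∑ i ∈ Finset.range (K + 1),
              N ^ ((i : ℝ) * ε + (J : ℝ) - (K : ℝ)) * CkNorm (K - i + J) f := by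
  obtain ⟨M, hM, hMb⟩ := VFar.exists_norm_iteratedFDeriv_scaled_farKernel_le hg K
  set C₀ : ℝ := VFar.kerConst * M * 4 ^ K * 2 ^ J with hC₀
  have hC₀0 : 0 ≤ C₀ :=
    mul_nonneg (mul_nonneg (mul_nonneg VFar.kerConst_nonneg hM) (by positivity)) (by positivity)
  refine ⟨C₀ + 1, by positivity, ?_⟩
  intro N hN a b Θ₀ hab f hf hsupp
  have hN0 : 0 < N := zero_lt_one.trans_le hN
  set R : ℝ := N ^ ε with hR
  have hR0 : 0 < R := Real.rpow_pos_of_pos hN0 ε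
  have hs := VFar.tsupport_subset_closedBall hsupp
  have hc := VFar.hasCompactSupport_of_tsupport_subset hs
  have hV : (fun x : ℝ × ℝ => ∫ h : ℝ × ℝ, (h.1 / (h.1 ^ 2 + h.2 ^ 2)) * f (x + h)
      * Real.sin (N * (b * (x.1 + h.1) + a * (x.2 + h.2)) + Θ₀) * (1 - g (R * rad h))) =
      VFar.corr (fun z => R * VFar.farKernel g (R • z)) (VFar.osc N a b Θ₀ f) := by
    ext x
    refine integral_congr_ae (Eventually.of_forall fun h => ?_)
    simp only [VFar.scaled_farKernel_apply hR0, VFar.osc, Prod.fst_add, Prod.snd_add]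
    ring
  have hsum : ∑ i ∈ Finset.range (K + 1),
      N ^ ((i : ℝ) * ε + (J : ℝ) - (K : ℝ)) * CkNorm (K - i + J) f =
      N ^ J / N ^ K * VFar.ckSum K J R f := by
    rw [VFar.ckSum, Finset.mul_sum]
    refine Finset.sum_congr rfl fun i _ => ?_
    rw [Real.rpow_sub hN0, Real.rpow_add hN0, Real.rpow_natCast, Real.rpow_natCast, mul_comm _ ε,
      Real.rpow_mul hN0.le, Real.rpow_natCast]
    ring
  have hS : 0 ≤ VFar.ckSum K J R f := VFar.ckSum_nonneg _ _ hR0.le _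
  rw [hV, hsum]
  refine Real.sSup_le ?_ (by positivity)
  rintro _ ⟨i, j, x, hij, rfl⟩
  have h1 := VFar.pow_mul_abs_pdMix_corr_osc_le hN0.le hab hR0.le hM
    (contDiff_const.mul ((VFar.contDiff_farKernel hg).comp (contDiff_const_smul R)))
    (hMb R hR0) hN x (i + j) rfl Θ₀
    (hf.of_le (by norm_cast; omega)) hs
  have h2 : (2 * N) ^ (i + j) * VFar.ckSum K (i + j) R f ≤ (2 * N) ^ J * VFar.ckSum K J R f := by
    gcongr
    · exact VFar.ckSum_nonneg _ _ hR0.le _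
    · linarith
    · exact VFar.ckSum_mono hij hR0.le (by exact_mod_cast hf) hc
  have h3 := h1.trans (mul_le_mul_of_nonneg_left h2
    (mul_nonneg (mul_nonneg VFar.kerConst_nonneg hM) (by positivity)))
  rw [← le_div_iff₀' (by positivity)] at h3
  calc |pdMix i j (VFar.corr (fun z => R * VFar.farKernel g (R • z)) (VFar.osc N a b Θ₀ f)) x|
      ≤ C₀ * (N ^ J / N ^ K * VFar.ckSum K J R f) := h3.trans_eq (by rw [hC₀, mul_pow]; ring)
    _ ≤ (C₀ + 1) * (N ^ J / N ^ K * VFar.ckSum K J R f) := by gcongr; linarith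
end

section
/- Taylor remainder estimate for the near part of the velocity operator: for every K ∈ ℕ, every ε ∈ (0,1) and every J ∈ ℕ there exists a constant C > 0, depending only on K, J, ε and g, such that for all N ≥ 1, all a, b, Θ₀ ∈ ℝ with a² + b² = 1, and every f ∈ C^{K+J+1}(ℝ²) with ‖f‖_{C^{K+J+1}} < ∞, one has ‖R_{K,N}‖_{C^J} ≤ C N^{J − (K+2)ε} ‖f‖_{C^{K+J+1}}. In particular, for J = 0, |R_{K,N}(x)| ≤ C N^{−(K+2)ε} ‖f‖_{C^{K+1}} for every x ∈ ℝ². -/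
open MeasureTheory Real Filter

/-- The linear form `h ↦ u h₁ + v h₂` on `ℝ²`. -/
noncomputable def covector (u v : ℝ) : ℝ × ℝ →L[ℝ] ℝ :=
  u • ContinuousLinearMap.fst ℝ ℝ ℝ + v • ContinuousLinearMap.snd ℝ ℝ ℝ

@[simp] lemma covector_apply (u v : ℝ) (h : ℝ × ℝ) : covector u v h = u * h.1 + v * h.2 := by
  simp [covector]

lemma covector_ext {L : ℝ × ℝ →L[ℝ] ℝ} {u v : ℝ} (hu : L (1, 0) = u) (hv : L (0, 1) = v) :
    L = covector u v := by
  ext <;> simp [hu, hv]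

lemma HasFDerivAt.to_covector {F : ℝ × ℝ → ℝ} {L : ℝ × ℝ →L[ℝ] ℝ} {u v : ℝ} {x : ℝ × ℝ}
    (hF : HasFDerivAt F L x) (hu : L (1, 0) = u) (hv : L (0, 1) = v) :
    HasFDerivAt F (covector u v) x :=
  covector_ext hu hv ▸ hF

lemma norm_covector_le (u v : ℝ) : ‖covector u v‖ ≤ |u| + |v| := by
  refine ContinuousLinearMap.opNorm_le_bound _ (by positivity) fun h => ?_
  rw [covector_apply, Real.norm_eq_abs]
  have h1 : |h.1| ≤ ‖h‖ := norm_fst_le h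
  have h2 : |h.2| ≤ ‖h‖ := norm_snd_le h
  calc |u * h.1 + v * h.2| ≤ |u| * |h.1| + |v| * |h.2| := by
        simpa [abs_mul] using abs_add_le (u * h.1) (v * h.2)
    _ ≤ (|u| + |v|) * ‖h‖ := by
        rw [add_mul]; gcongr

lemma Differentiable.hasFDerivAt_covector {F : ℝ × ℝ → ℝ} (hF : Differentiable ℝ F) (x : ℝ × ℝ) :
    HasFDerivAt F (covector (pd1 F x) (pd2 F x)) x :=
  (hF x).hasFDerivAt.to_covector rfl rfl

lemma HasFDerivAt.pd1_eq {F : ℝ × ℝ → ℝ} {u v : ℝ} {x : ℝ × ℝ}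
    (hF : HasFDerivAt F (covector u v) x) : pd1 F x = u := by
  simp [pd1, hF.fderiv]

lemma HasFDerivAt.pd2_eq {F : ℝ × ℝ → ℝ} {u v : ℝ} {x : ℝ × ℝ}
    (hF : HasFDerivAt F (covector u v) x) : pd2 F x = v := by
  simp [pd2, hF.fderiv]

lemma contDiff_pd1 {k : ℕ} {F : ℝ × ℝ → ℝ} (hF : ContDiff ℝ (k + 1 : ℕ) F) :
    ContDiff ℝ k (pd1 F) :=
  (hF.fderiv_right (by norm_cast)).clm_apply contDiff_const

lemma contDiff_pd2 {k : ℕ} {F : ℝ × ℝ → ℝ} (hF : ContDiff ℝ (k + 1 : ℕ) F) :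
    ContDiff ℝ k (pd2 F) :=
  (hF.fderiv_right (by norm_cast)).clm_apply contDiff_const

lemma pd1_pd2_comm {F : ℝ × ℝ → ℝ} (hF : ContDiff ℝ 2 F) : pd1 (pd2 F) = pd2 (pd1 F) := by
  funext x
  have hd : DifferentiableAt ℝ (fderiv ℝ F) x :=
    ((hF.fderiv_right (m := 1) (by norm_num)).differentiable (by norm_num)) x
  have hs : IsSymmSndFDerivAt ℝ F x := hF.contDiffAt.isSymmSndFDerivAt (by simp)
  have key : ∀ v w : ℝ × ℝ, fderiv ℝ (fun y => fderiv ℝ F y v) x w =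
      fderiv ℝ (fderiv ℝ F) x w v := fun v w => by
    rw [(hd.hasFDerivAt.clm_apply (hasFDerivAt_const v x)).fderiv]; simp
  change fderiv ℝ (fun y => fderiv ℝ F y (0, 1)) x (1, 0) =
    fderiv ℝ (fun y => fderiv ℝ F y (1, 0)) x (0, 1)
  rw [key, key, hs]

lemma pd1_iterate_pd2 (q : ℕ) {F : ℝ × ℝ → ℝ} (hF : ContDiff ℝ (q + 1 : ℕ) F) :
    pd1 (pd2^[q] F) = pd2^[q] (pd1 F) := by
  induction q generalizing F with
  | zero => rfl
  | succ q ih =>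
    rw [Function.iterate_succ_apply, Function.iterate_succ_apply, ih (contDiff_pd2 hF),
      pd1_pd2_comm (hF.of_le (by norm_cast; omega))]

lemma pd2_iterate_pd1 (p : ℕ) {F : ℝ × ℝ → ℝ} (hF : ContDiff ℝ (p + 1 : ℕ) F) :
    pd2 (pd1^[p] F) = pd1^[p] (pd2 F) := by
  induction p generalizing F with
  | zero => rfl
  | succ p ih =>
    rw [Function.iterate_succ_apply, Function.iterate_succ_apply, ih (contDiff_pd1 hF),
      pd1_pd2_comm (hF.of_le (by norm_cast; omega))]

lemma contDiff_iterate_pd2 (q k : ℕ) {F : ℝ × ℝ → ℝ} (hF : ContDiff ℝ (k + q : ℕ) F) :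
    ContDiff ℝ k (pd2^[q] F) := by
  induction q generalizing F with
  | zero => exact hF
  | succ q ih => exact ih (contDiff_pd2 hF)

lemma contDiff_iterate_pd1 (p k : ℕ) {F : ℝ × ℝ → ℝ} (hF : ContDiff ℝ (k + p : ℕ) F) :
    ContDiff ℝ k (pd1^[p] F) := by
  induction p generalizing F with
  | zero => exact hF
  | succ p ih => exact ih (contDiff_pd1 hF)

lemma contDiff_pdMix (p q k : ℕ) {F : ℝ × ℝ → ℝ} (hF : ContDiff ℝ (k + p + q : ℕ) F) :
    ContDiff ℝ k (pdMix p q F) :=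
  contDiff_iterate_pd1 p k (contDiff_iterate_pd2 q (k + p) hF)

lemma pdMix_succ_left (p q : ℕ) {F : ℝ × ℝ → ℝ} (hF : ContDiff ℝ (q + 1 : ℕ) F) :
    pdMix (p + 1) q F = pdMix p q (pd1 F) := by
  rw [pdMix, Function.iterate_succ_apply, pd1_iterate_pd2 q hF, pdMix]

lemma pdMix_succ_right (p q : ℕ) (F : ℝ × ℝ → ℝ) : pdMix p (q + 1) F = pdMix p q (pd2 F) := rfl

lemma pd1_pdMix (p q : ℕ) {F : ℝ × ℝ → ℝ} (hF : ContDiff ℝ (q + 1 : ℕ) F) :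
    pd1 (pdMix p q F) = pdMix p q (pd1 F) := by
  rw [← pdMix_succ_left p q hF, pdMix, pdMix, Function.iterate_succ_apply']

lemma pd2_pdMix (p q : ℕ) {F : ℝ × ℝ → ℝ} (hF : ContDiff ℝ (p + q + 1 : ℕ) F) :
    pd2 (pdMix p q F) = pdMix p q (pd2 F) := by
  rw [pdMix, pdMix, pd2_iterate_pd1 p (contDiff_iterate_pd2 q (p + 1) (hF.of_le
    (by norm_cast; omega))), ← Function.iterate_succ_apply' pd2, Function.iterate_succ_apply]

/-- `F` is of class `C^k` and its partial derivatives of order at most `k` are bounded by `M`. -/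
structure BddDeriv (k : ℕ) (M : ℝ) (F : ℝ × ℝ → ℝ) : Prop where
  contDiff : ContDiff ℝ k F
  abs_le : ∀ i j : ℕ, ∀ x : ℝ × ℝ, i + j ≤ k → |pdMix i j F x| ≤ M

namespace BddDeriv

variable {k : ℕ} {M B : ℝ} {F G : ℝ × ℝ → ℝ}

lemma abs_apply_le (hF : BddDeriv k M F) (x : ℝ × ℝ) : |F x| ≤ M := hF.abs_le 0 0 x (by simp)

lemma nonneg (hF : BddDeriv k M F) : 0 ≤ M := (abs_nonneg _).trans (hF.abs_apply_le 0)

lemma of_le {l : ℕ} (hF : BddDeriv k M F) (hl : l ≤ k) : BddDeriv l M F :=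
  ⟨hF.contDiff.of_le (by exact_mod_cast hl), fun i j x h => hF.abs_le i j x (h.trans hl)⟩

lemma mono (hF : BddDeriv k M F) (hB : M ≤ B) : BddDeriv k B F :=
  ⟨hF.contDiff, fun i j x h => (hF.abs_le i j x h).trans hB⟩

lemma pd1 (hF : BddDeriv (k + 1) M F) : BddDeriv k M (pd1 F) where
  contDiff := contDiff_pd1 hF.contDiff
  abs_le i j x h := by
    rw [← pdMix_succ_left i j (hF.contDiff.of_le (by norm_cast; omega))]
    exact hF.abs_le _ _ _ (by omega)

lemma pd2 (hF : BddDeriv (k + 1) M F) : BddDeriv k M (pd2 F) where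
  contDiff := contDiff_pd2 hF.contDiff
  abs_le i j x h := by
    rw [← pdMix_succ_right]
    exact hF.abs_le _ _ _ (by omega)

lemma zero (hF : Continuous F) (hM : ∀ x, |F x| ≤ M) : BddDeriv 0 M F where
  contDiff := by exact_mod_cast contDiff_zero.2 hF
  abs_le i j x h := by
    obtain ⟨rfl, rfl⟩ : i = 0 ∧ j = 0 := by omega
    exact hM x

lemma succ (hF : Differentiable ℝ F) (hM : ∀ x, |F x| ≤ M) (h1 : BddDeriv k M (_root_.pd1 F))
    (h2 : BddDeriv k M (_root_.pd2 F)) : BddDeriv (k + 1) M F := by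
  have hc : ContDiff ℝ (k + 1 : ℕ) F := by
    push_cast
    refine contDiff_succ_iff_hasFDerivAt.2 ⟨fun x => covector (_root_.pd1 F x) (_root_.pd2 F x), ?_,
      fun x => hF.hasFDerivAt_covector x⟩
    exact (h1.contDiff.smul contDiff_const).add (h2.contDiff.smul contDiff_const)
  refine ⟨hc, fun i j x h => ?_⟩
  rcases j with _ | j
  · rcases i with _ | i
    · exact hM x
    · exact h1.abs_le i 0 x (by omega)
  · exact h2.abs_le i j x (by omega)

lemma add (hF : BddDeriv k M F) (hG : BddDeriv k B G) :
    BddDeriv k (M + B) (fun x => F x + G x) := by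
  have hle (x) : |F x + G x| ≤ M + B :=
    (abs_add_le _ _).trans (add_le_add (hF.abs_apply_le x) (hG.abs_apply_le x))
  induction k generalizing F G with
  | zero => exact zero (hF.contDiff.continuous.add hG.contDiff.continuous) hle
  | succ k ih =>
    have dF := hF.contDiff.differentiable (by simp)
    have dG := hG.contDiff.differentiable (by simp)
    have hd (x) : HasFDerivAt (fun x => F x + G x) (covector (_root_.pd1 F x + _root_.pd1 G x)
        (_root_.pd2 F x + _root_.pd2 G x)) x :=
      ((dF.hasFDerivAt_covector x).add (dG.hasFDerivAt_covector x)).to_covector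
        (by simp) (by simp)
    refine succ (fun x => (hd x).differentiableAt) hle ?_ ?_
    · rw [funext fun x => (hd x).pd1_eq]
      exact ih hF.pd1 hG.pd1 fun x =>
        (abs_add_le _ _).trans (add_le_add (hF.pd1.abs_apply_le x) (hG.pd1.abs_apply_le x))
    · rw [funext fun x => (hd x).pd2_eq]
      exact ih hF.pd2 hG.pd2 fun x =>
        (abs_add_le _ _).trans (add_le_add (hF.pd2.abs_apply_le x) (hG.pd2.abs_apply_le x))

lemma const_mul (c : ℝ) (hF : BddDeriv k M F) : BddDeriv k (|c| * M) (fun x => c * F x) := by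
  have hle (x) : |c * F x| ≤ |c| * M := by
    rw [abs_mul]
    exact mul_le_mul_of_nonneg_left (hF.abs_apply_le x) (abs_nonneg c)
  induction k generalizing F with
  | zero => exact zero (hF.contDiff.continuous.const_mul c) hle
  | succ k ih =>
    have dF := hF.contDiff.differentiable (by simp)
    have hd (x) : HasFDerivAt (fun x => c * F x)
        (covector (c * _root_.pd1 F x) (c * _root_.pd2 F x)) x :=
      ((dF.hasFDerivAt_covector x).const_mul c).to_covector (by simp) (by simp)
    have hle' {G : ℝ × ℝ → ℝ} (hG : BddDeriv k M G) (x) : |c * G x| ≤ |c| * M := by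
      rw [abs_mul]
      exact mul_le_mul_of_nonneg_left (hG.abs_apply_le x) (abs_nonneg c)
    refine succ (fun x => (hd x).differentiableAt) hle ?_ ?_
    · rw [funext fun x => (hd x).pd1_eq]
      exact ih hF.pd1 (hle' hF.pd1)
    · rw [funext fun x => (hd x).pd2_eq]
      exact ih hF.pd2 (hle' hF.pd2)

end BddDeriv

/-- The homogeneous part of degree `i` of the Taylor polynomial of `F` at `x`. -/
noncomputable def taylorTerm (i : ℕ) (F : ℝ × ℝ → ℝ) (x h : ℝ × ℝ) : ℝ :=
  ∑ p ∈ Finset.HasAntidiagonal.antidiagonal i, pdMix p.2 p.1 F x * h.1 ^ p.2 * h.2 ^ p.1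
    / ((Nat.factorial p.2 : ℝ) * (Nat.factorial p.1 : ℝ))

/-- The remainder of the Taylor expansion of `F` at `x` up to (excluding) order `n`. -/
noncomputable def taylorRem (n : ℕ) (F : ℝ × ℝ → ℝ) (x h : ℝ × ℝ) : ℝ :=
  F (x + h) - ∑ i ∈ Finset.range n, taylorTerm i F x h

lemma taylorTerm_eq_sum_range (i : ℕ) (F : ℝ × ℝ → ℝ) (x h : ℝ × ℝ) :
    taylorTerm i F x h = ∑ j ∈ Finset.range (i + 1), pdMix (i - j) j F x * h.1 ^ (i - j) * h.2 ^ j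
      / ((Nat.factorial (i - j) : ℝ) * (Nat.factorial j : ℝ)) :=
  Finset.Nat.sum_antidiagonal_eq_sum_range_succ (fun j p => pdMix p j F x * h.1 ^ p * h.2 ^ j
    / ((Nat.factorial p : ℝ) * (Nat.factorial j : ℝ))) i

lemma hasFDerivAt_taylorTerm_left {i : ℕ} {F : ℝ × ℝ → ℝ} (hF : ContDiff ℝ (i + 1 : ℕ) F)
    (x h : ℝ × ℝ) : HasFDerivAt (fun x => taylorTerm i F x h)
      (covector (taylorTerm i (pd1 F) x h) (taylorTerm i (pd2 F) x h)) x := by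
  have key : ∀ p ∈ Finset.HasAntidiagonal.antidiagonal i, HasFDerivAt (fun x => pdMix p.2 p.1 F x * h.1 ^ p.2 *
      h.2 ^ p.1 / ((Nat.factorial p.2 : ℝ) * (Nat.factorial p.1 : ℝ)))
      ((h.1 ^ p.2 * h.2 ^ p.1 / ((Nat.factorial p.2 : ℝ) * (Nat.factorial p.1 : ℝ))) •
        covector (pdMix p.2 p.1 (pd1 F) x) (pdMix p.2 p.1 (pd2 F) x)) x := fun p hp => by
    rw [Finset.HasAntidiagonal.mem_antidiagonal] at hp
    have hd : Differentiable ℝ (pdMix p.2 p.1 F) :=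
      (contDiff_pdMix p.2 p.1 1 (hF.of_le (by norm_cast; omega))).differentiable (by simp)
    have := (hd.hasFDerivAt_covector x).mul_const
      (h.1 ^ p.2 * h.2 ^ p.1 / ((Nat.factorial p.2 : ℝ) * (Nat.factorial p.1 : ℝ)))
    rw [pd1_pdMix _ _ (hF.of_le (by norm_cast; omega)),
      pd2_pdMix _ _ (hF.of_le (by norm_cast; omega))] at this
    refine this.congr_of_eventuallyEq (.of_forall fun y => ?_)
    ring
  refine (HasFDerivAt.fun_sum key).to_covector ?_ ?_ <;>
  · simp only [_root_.sum_apply, _root_.smul_apply, covector_apply,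
      smul_eq_mul, taylorTerm]
    exact Finset.sum_congr rfl fun p _ => by ring

lemma hasFDerivAt_taylorTerm_succ_right {i : ℕ} {F : ℝ × ℝ → ℝ}
    (hF : ContDiff ℝ (i + 1 : ℕ) F) (x h : ℝ × ℝ) : HasFDerivAt (taylorTerm (i + 1) F x)
      (covector (taylorTerm i (pd1 F) x h) (taylorTerm i (pd2 F) x h)) h := by
  have key : ∀ p ∈ Finset.HasAntidiagonal.antidiagonal (i + 1), HasFDerivAt (fun h : ℝ × ℝ =>
      pdMix p.2 p.1 F x * h.1 ^ p.2 *
      h.2 ^ p.1 / ((Nat.factorial p.2 : ℝ) * (Nat.factorial p.1 : ℝ)))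
      (covector
        (pdMix p.2 p.1 F x * (p.2 * h.1 ^ (p.2 - 1)) * h.2 ^ p.1 /
          ((Nat.factorial p.2 : ℝ) * (Nat.factorial p.1 : ℝ)))
        (pdMix p.2 p.1 F x * h.1 ^ p.2 * (p.1 * h.2 ^ (p.1 - 1)) /
          ((Nat.factorial p.2 : ℝ) * (Nat.factorial p.1 : ℝ)))) h := fun p _ => by
    have h1 := ((hasFDerivAt_fst (𝕜 := ℝ) (p := h)).pow p.2)
    have h2 := ((hasFDerivAt_snd (𝕜 := ℝ) (p := h)).pow p.1)
    refine (((h1.const_mul (pdMix p.2 p.1 F x)).mul h2).mul_const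
      ((Nat.factorial p.2 : ℝ) * (Nat.factorial p.1 : ℝ))⁻¹).to_covector ?_ ?_ <;>
    · simp
      ring
  refine (HasFDerivAt.fun_sum key).to_covector ?_ ?_
  · simp only [_root_.sum_apply, covector_apply, taylorTerm]
    rw [Finset.Nat.sum_antidiagonal_succ']
    simp only [Nat.cast_zero, zero_mul, mul_zero, zero_div, mul_one, add_zero, zero_add]
    refine Finset.sum_congr rfl fun p hp => ?_
    rw [Finset.HasAntidiagonal.mem_antidiagonal] at hp
    rw [pdMix_succ_left _ _ (hF.of_le (by norm_cast; omega)), Nat.factorial_succ]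
    push_cast
    field_simp
  · simp only [_root_.sum_apply, covector_apply, taylorTerm]
    rw [Finset.Nat.sum_antidiagonal_succ]
    simp only [Nat.cast_zero, zero_mul, mul_zero, zero_div, mul_one, add_zero, zero_add]
    refine Finset.sum_congr rfl fun p hp => ?_
    rw [pdMix_succ_right, Nat.factorial_succ]
    push_cast
    field_simp

lemma hasFDerivAt_taylorRem_left {n : ℕ} {F : ℝ × ℝ → ℝ} (hF : ContDiff ℝ (n + 1 : ℕ) F)
    (x h : ℝ × ℝ) : HasFDerivAt (fun x => taylorRem n F x h)
      (covector (taylorRem n (pd1 F) x h) (taylorRem n (pd2 F) x h)) x := by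
  have hd : Differentiable ℝ F := hF.differentiable (by simp)
  have h1 : HasFDerivAt (fun x => F (x + h)) (covector (pd1 F (x + h)) (pd2 F (x + h))) x :=
    (hasFDerivAt_comp_add_right h).2 (hd.hasFDerivAt_covector (x + h))
  exact (h1.sub (HasFDerivAt.fun_sum (u := Finset.range n) fun i hi =>
    hasFDerivAt_taylorTerm_left (i := i) (hF.of_le (by
      have := Finset.mem_range.1 hi
      norm_cast; omega)) x h)).to_covector (by simp [taylorRem]) (by simp [taylorRem])

lemma hasFDerivAt_taylorRem_succ_right {n : ℕ} {F : ℝ × ℝ → ℝ} (hF : ContDiff ℝ (n + 1 : ℕ) F)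
    (x h : ℝ × ℝ) : HasFDerivAt (taylorRem (n + 1) F x)
      (covector (taylorRem n (pd1 F) x h) (taylorRem n (pd2 F) x h)) h := by
  have hd : Differentiable ℝ F := hF.differentiable (by simp)
  have h1 : HasFDerivAt (fun h => F (x + h)) (covector (pd1 F (x + h)) (pd2 F (x + h))) h :=
    (hasFDerivAt_comp_add_left x).2 (hd.hasFDerivAt_covector (x + h))
  have h2 := HasFDerivAt.fun_sum (u := Finset.range n) fun i hi =>
    hasFDerivAt_taylorTerm_succ_right (i := i) (hF.of_le (by
      have := Finset.mem_range.1 hi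
      norm_cast; omega)) x h
  have h3 := ((h1.sub h2).sub_const (F x)).to_covector (u := taylorRem n (pd1 F) x h)
    (v := taylorRem n (pd2 F) x h) (by simp [taylorRem]) (by simp [taylorRem])
  refine h3.congr_of_eventuallyEq (.of_forall fun y => ?_)
  simp only [taylorRem, Finset.sum_range_succ', Pi.sub_apply]
  simp [taylorTerm, pdMix]
  ring

lemma taylorRem_succ_zero (n : ℕ) (F : ℝ × ℝ → ℝ) (x : ℝ × ℝ) :
    taylorRem (n + 1) F x 0 = 0 := by
  have (i : ℕ) : taylorTerm (i + 1) F x 0 = 0 := Finset.sum_eq_zero fun p hp => by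
    rw [Finset.HasAntidiagonal.mem_antidiagonal] at hp
    rcases Nat.eq_zero_or_pos p.1 with h | h
    · have : p.2 ≠ 0 := by omega
      simp [this]
    · simp [h.ne']
  rw [taylorRem, Finset.sum_range_succ']
  simp only [this, Finset.sum_const_zero]
  simp [taylorTerm, pdMix]

lemma abs_taylorRem_le {n : ℕ} {M : ℝ} {F : ℝ × ℝ → ℝ} (hF : BddDeriv n M F) (x h : ℝ × ℝ) :
    |taylorRem n F x h| ≤ 2 ^ n * M * ‖h‖ ^ n := by
  induction n generalizing F h with
  | zero => simpa [taylorRem] using hF.abs_apply_le (x + h)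
  | succ n ih =>
    have hM := hF.nonneg
    have := (convex_closedBall (0 : ℝ × ℝ) ‖h‖).norm_image_sub_le_of_norm_hasFDerivWithin_le
      (C := 2 ^ (n + 1) * M * ‖h‖ ^ n)
      (fun y _ => (hasFDerivAt_taylorRem_succ_right hF.contDiff x y).hasFDerivWithinAt)
      (fun y hy => by
        have hy : ‖y‖ ≤ ‖h‖ := by simpa using hy
        calc _ ≤ _ := norm_covector_le _ _
          _ ≤ 2 ^ n * M * ‖y‖ ^ n + 2 ^ n * M * ‖y‖ ^ n := add_le_add (ih hF.pd1 y) (ih hF.pd2 y)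
          _ = 2 ^ (n + 1) * M * ‖y‖ ^ n := by ring
          _ ≤ _ := by gcongr)
      (x := 0) (y := h) (by simp) (by simp)
    rw [taylorRem_succ_zero, sub_zero, sub_zero, Real.norm_eq_abs] at this
    exact this.trans_eq (by ring)

lemma continuous_taylorRem (n : ℕ) {F : ℝ × ℝ → ℝ} (hF : Continuous F) (x : ℝ × ℝ) :
    Continuous (taylorRem n F x) := by
  unfold taylorRem taylorTerm
  fun_prop

/-- The Taylor remainder multiplied by the oscillating phase. -/
noncomputable def oscRem (n : ℕ) (N a b θ : ℝ) (F : ℝ × ℝ → ℝ) (x h : ℝ × ℝ) : ℝ :=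
  taylorRem n F x h * Real.sin (N * (a * (x.2 + h.2) + b * (x.1 + h.1)) + θ)

lemma continuous_oscRem (n : ℕ) (N a b θ : ℝ) {F : ℝ × ℝ → ℝ} (hF : Continuous F) (x : ℝ × ℝ) :
    Continuous (oscRem n N a b θ F x) :=
  (continuous_taylorRem n hF x).mul (by fun_prop)

lemma abs_oscRem_le {n : ℕ} {M : ℝ} {F : ℝ × ℝ → ℝ} (hF : BddDeriv n M F) (N a b θ : ℝ)
    (x h : ℝ × ℝ) : |oscRem n N a b θ F x h| ≤ 2 ^ n * M * ‖h‖ ^ n := by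
  rw [oscRem, abs_mul]
  exact (mul_le_of_le_one_right (abs_nonneg _) (Real.abs_sin_le_one _)).trans
    (abs_taylorRem_le hF x h)

lemma hasFDerivAt_oscRem {n : ℕ} {F : ℝ × ℝ → ℝ} (hF : ContDiff ℝ (n + 1 : ℕ) F)
    (N a b θ : ℝ) (x h : ℝ × ℝ) : HasFDerivAt (fun x => oscRem n N a b θ F x h)
      (covector
        (oscRem n N a b θ (pd1 F) x h + N * b * oscRem n N a b (θ + π / 2) F x h)
        (oscRem n N a b θ (pd2 F) x h + N * a * oscRem n N a b (θ + π / 2) F x h)) x := by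
  have h1 := (hasFDerivAt_fst (𝕜 := ℝ) (p := x)).add_const h.1
  have h2 := (hasFDerivAt_snd (𝕜 := ℝ) (p := x)).add_const h.2
  have h3 := (((h2.const_mul a).add (h1.const_mul b)).const_mul N).add_const θ
  have hs (y : ℝ) : Real.sin (y + (θ + π / 2)) = Real.cos (y + θ) := by
    rw [← add_assoc, Real.sin_add_pi_div_two]
  refine ((hasFDerivAt_taylorRem_left hF x h).mul h3.sin).to_covector ?_ ?_ <;>
  · simp [oscRem, hs]
    ring

lemma continuous_oscRem_left {n : ℕ} {F : ℝ × ℝ → ℝ} (hF : ContDiff ℝ n F) (N a b θ : ℝ)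
    (h : ℝ × ℝ) : Continuous fun x => oscRem n N a b θ F x h := by
  have hF' := hF.continuous
  have hterm (i) (hi : i ∈ Finset.range n) : Continuous fun x => taylorTerm i F x h :=
    continuous_finsetSum _ fun p hp => by
      rw [Finset.mem_range] at hi
      rw [Finset.HasAntidiagonal.mem_antidiagonal] at hp
      have := (contDiff_pdMix p.2 p.1 0 (hF.of_le (by norm_cast; omega))).continuous
      fun_prop
  have hsum := continuous_finsetSum _ hterm
  unfold oscRem taylorRem
  fun_prop

/-- The Biot–Savart type kernel `h₁ / |h|²` cut off at distance `1 / c` from the origin. -/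
noncomputable def cutoffKernel (g : ℝ → ℝ) (c : ℝ) (h : ℝ × ℝ) : ℝ :=
  h.1 / (h.1 ^ 2 + h.2 ^ 2) * g (c * rad h)

lemma norm_le_rad (h : ℝ × ℝ) : ‖h‖ ≤ rad h :=
  sup_le (Real.abs_le_sqrt (by nlinarith [sq_nonneg h.2]))
    (Real.abs_le_sqrt (by nlinarith [sq_nonneg h.1]))

lemma abs_div_sq_add_sq_mul_norm_le (h : ℝ × ℝ) : |h.1 / (h.1 ^ 2 + h.2 ^ 2)| * ‖h‖ ≤ 1 := by
  have hD : 0 ≤ h.1 ^ 2 + h.2 ^ 2 := by positivity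
  have h1 : |h.1| ≤ ‖h‖ := norm_fst_le h
  have h2 : ‖h‖ ^ 2 ≤ h.1 ^ 2 + h.2 ^ 2 :=
    (Real.le_sqrt (norm_nonneg h) hD).1 (norm_le_rad h)
  rw [abs_div, abs_of_nonneg hD, div_mul_eq_mul_div]
  refine div_le_one_of_le₀ (le_trans ?_ h2) hD
  nlinarith [norm_nonneg h]

lemma IsCutoff.abs_le_one {g : ℝ → ℝ} (hg : IsCutoff g) {r : ℝ} (hr : 0 ≤ r) : |g r| ≤ 1 := by
  obtain ⟨-, hanti, h0, h1⟩ := hg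
  have hle : g r ≤ 1 := h0 0 (by norm_num) ▸ hanti Set.self_mem_Ici hr hr
  have hge : 0 ≤ g r := by
    rcases le_total r 1 with h | h
    · exact h1 1 le_rfl ▸ hanti hr (Set.mem_Ici.2 zero_le_one) h
    · exact (h1 r h).ge
  rwa [abs_of_nonneg hge]

lemma abs_cutoffKernel_mul_le {g : ℝ → ℝ} (hg : IsCutoff g) {c : ℝ} (hc : 0 < c) (k : ℕ)
    (h : ℝ × ℝ) : |cutoffKernel g c h| * ‖h‖ ^ (k + 1) ≤
      (Metric.closedBall (0 : ℝ × ℝ) c⁻¹).indicator (fun _ => c⁻¹ ^ k) h := by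
  have hr : 0 ≤ rad h := Real.sqrt_nonneg _
  by_cases hh : ‖h‖ ≤ c⁻¹
  · rw [Set.indicator_of_mem (by simpa using hh), cutoffKernel, abs_mul]
    calc _ = (|h.1 / (h.1 ^ 2 + h.2 ^ 2)| * ‖h‖) * |g (c * rad h)| * ‖h‖ ^ k := by ring
      _ ≤ 1 * 1 * c⁻¹ ^ k := by
        gcongr
        · exact abs_div_sq_add_sq_mul_norm_le h
        · exact hg.abs_le_one (by positivity)
      _ = c⁻¹ ^ k := by ring
  · rw [Set.indicator_of_notMem (by simpa using hh), cutoffKernel, hg.2.2.2]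
    · simp
    · have := (not_le.1 hh).le.trans (norm_le_rad h)
      rwa [inv_le_iff_one_le_mul₀' hc] at this

lemma measurable_cutoffKernel {g : ℝ → ℝ} (hg : IsCutoff g) (c : ℝ) :
    Measurable (cutoffKernel g c) := by
  have := hg.1.continuous.measurable
  unfold cutoffKernel rad
  fun_prop

lemma volume_real_closedBall_prod {r : ℝ} (hr : 0 ≤ r) :
    volume.real (Metric.closedBall (0 : ℝ × ℝ) r) = 4 * r ^ 2 := by
  rw [← Prod.mk_zero_zero, ← closedBall_prod_same, Measure.volume_eq_prod, measureReal_prod_prod,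
    Real.volume_real_closedBall hr]
  ring

lemma integrable_indicator_closedBall (r A : ℝ) :
    Integrable ((Metric.closedBall (0 : ℝ × ℝ) r).indicator fun _ => A) :=
  (integrable_indicator_iff Metric.isClosed_closedBall.measurableSet).2
    (integrableOn_const measure_closedBall_lt_top.ne)

lemma norm_cutoffKernel_mul_le {g : ℝ → ℝ} (hg : IsCutoff g) {c : ℝ} (hc : 0 < c) {k : ℕ} {A u : ℝ}
    {h : ℝ × ℝ} (hA : 0 ≤ A) (hu : |u| ≤ A * ‖h‖ ^ (k + 1)) : |cutoffKernel g c h * u| ≤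
      (Metric.closedBall (0 : ℝ × ℝ) c⁻¹).indicator (fun _ => A * c⁻¹ ^ k) h := by
  rw [abs_mul]
  calc _ ≤ |cutoffKernel g c h| * (A * ‖h‖ ^ (k + 1)) := by gcongr
    _ = A * (|cutoffKernel g c h| * ‖h‖ ^ (k + 1)) := by ring
    _ ≤ A * (Metric.closedBall (0 : ℝ × ℝ) c⁻¹).indicator (fun _ => c⁻¹ ^ k) h := by
      gcongr
      exact abs_cutoffKernel_mul_le hg hc k h
    _ = _ := (Set.indicator_const_mul _ _ _ h).symm

/-- The near part of the velocity operator applied to the Taylor remainder of `F`. -/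
noncomputable def nearRem (g : ℝ → ℝ) (c : ℝ) (n : ℕ) (N a b θ : ℝ) (F : ℝ × ℝ → ℝ)
    (x : ℝ × ℝ) : ℝ :=
  ∫ h : ℝ × ℝ, cutoffKernel g c h * oscRem n N a b θ F x h

section nearRem

variable {g : ℝ → ℝ} {c : ℝ} {k : ℕ} {M : ℝ} {F : ℝ × ℝ → ℝ}

lemma aestronglyMeasurable_cutoffKernel_mul_oscRem (hg : IsCutoff g) (hF : Continuous F) (n : ℕ)
    (N a b θ : ℝ) (x : ℝ × ℝ) :
    AEStronglyMeasurable fun h => cutoffKernel g c h * oscRem n N a b θ F x h :=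
  ((measurable_cutoffKernel hg c).mul
    (continuous_oscRem n N a b θ hF x).measurable).aestronglyMeasurable

lemma integrable_cutoffKernel_mul_oscRem (hg : IsCutoff g) (hc : 0 < c) (hF : BddDeriv (k + 1) M F)
    (N a b θ : ℝ)
    (x : ℝ × ℝ) : Integrable fun h => cutoffKernel g c h * oscRem (k + 1) N a b θ F x h :=
  (integrable_indicator_closedBall c⁻¹ (2 ^ (k + 1) * M * c⁻¹ ^ k)).mono'
    (aestronglyMeasurable_cutoffKernel_mul_oscRem hg hF.contDiff.continuous _ N a b θ x)
    (.of_forall fun h => norm_cutoffKernel_mul_le hg hc (by have := hF.nonneg; positivity)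
      (abs_oscRem_le hF N a b θ x h))

lemma abs_nearRem_le (hg : IsCutoff g) (hc : 0 < c) (hF : BddDeriv (k + 1) M F)
    (N a b θ : ℝ) (x : ℝ × ℝ) :
    |nearRem g c (k + 1) N a b θ F x| ≤ 2 ^ (k + 3) * c⁻¹ ^ (k + 2) * M := by
  refine (norm_integral_le_of_norm_le
    (f := fun h => cutoffKernel g c h * oscRem (k + 1) N a b θ F x h)
    (integrable_indicator_closedBall c⁻¹ (2 ^ (k + 1) * M * c⁻¹ ^ k))
    (.of_forall fun h => norm_cutoffKernel_mul_le hg hc (by have := hF.nonneg; positivity)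
      (abs_oscRem_le hF N a b θ x h))).trans_eq ?_
  rw [integral_indicator_const _ Metric.isClosed_closedBall.measurableSet,
    volume_real_closedBall_prod (by positivity), smul_eq_mul]
  ring

lemma hasFDerivAt_nearRem (hg : IsCutoff g) (hc : 0 < c) (hF : BddDeriv (k + 2) M F)
    (N a b θ : ℝ) (x : ℝ × ℝ) :
    HasFDerivAt (nearRem g c (k + 1) N a b θ F)
      (covector
        (nearRem g c (k + 1) N a b θ (pd1 F) x + N * b * nearRem g c (k + 1) N a b (θ + π / 2) F x)
        (nearRem g c (k + 1) N a b θ (pd2 F) x + N * a * nearRem g c (k + 1) N a b (θ + π / 2) F x))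
      x := by
  have hM := hF.nonneg
  have hF' : BddDeriv (k + 1) M F := hF.of_le (by omega)
  set u : ℝ × ℝ → ℝ × ℝ → ℝ := fun y h =>
    oscRem (k + 1) N a b θ (pd1 F) y h + N * b * oscRem (k + 1) N a b (θ + π / 2) F y h with hu
  set v : ℝ × ℝ → ℝ × ℝ → ℝ := fun y h =>
    oscRem (k + 1) N a b θ (pd2 F) y h + N * a * oscRem (k + 1) N a b (θ + π / 2) F y h with hv
  have hle {G : ℝ × ℝ → ℝ} (hG : BddDeriv (k + 1) M G) (d : ℝ) (y h : ℝ × ℝ) :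
      |oscRem (k + 1) N a b θ G y h + d * oscRem (k + 1) N a b (θ + π / 2) F y h| ≤
        (2 ^ (k + 1) * M * (1 + |d|)) * ‖h‖ ^ (k + 1) := by
    calc _ ≤ |oscRem (k + 1) N a b θ G y h| + |d| * |oscRem (k + 1) N a b (θ + π / 2) F y h| := by
          rw [← abs_mul]; exact abs_add_le _ _
      _ ≤ 2 ^ (k + 1) * M * ‖h‖ ^ (k + 1) + |d| * (2 ^ (k + 1) * M * ‖h‖ ^ (k + 1)) := by
          gcongr
          · exact abs_oscRem_le hG N a b θ y h
          · exact abs_oscRem_le hF' N a b _ y h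
      _ = _ := by ring
  set D : ℝ → ℝ × ℝ → ℝ := fun d => (Metric.closedBall (0 : ℝ × ℝ) c⁻¹).indicator
    (fun _ => (2 ^ (k + 1) * M * (1 + |d|)) * c⁻¹ ^ k) with hD
  have hbound (y h : ℝ × ℝ) :
      ‖covector (cutoffKernel g c h * u y h) (cutoffKernel g c h * v y h)‖ ≤
        D (N * b) h + D (N * a) h :=
    (norm_covector_le _ _).trans (add_le_add
      (norm_cutoffKernel_mul_le hg hc (by positivity) (hle hF.pd1 (N * b) y h))
      (norm_cutoffKernel_mul_le hg hc (by positivity) (hle hF.pd2 (N * a) y h)))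
  have hDint : Integrable fun h => D (N * b) h + D (N * a) h :=
    (integrable_indicator_closedBall _ _).add (integrable_indicator_closedBall _ _)
  have hcu : Continuous (u x) := (continuous_oscRem _ _ _ _ _ hF.pd1.contDiff.continuous x).add
    ((continuous_oscRem _ _ _ _ _ hF.contDiff.continuous x).const_mul _)
  have hcv : Continuous (v x) := (continuous_oscRem _ _ _ _ _ hF.pd2.contDiff.continuous x).add
    ((continuous_oscRem _ _ _ _ _ hF.contDiff.continuous x).const_mul _)
  have hmeas : AEStronglyMeasurable fun h =>
      covector (cutoffKernel g c h * u x h) (cutoffKernel g c h * v x h) := by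
    have hk := measurable_cutoffKernel hg c
    exact ((hk.mul hcu.measurable).aestronglyMeasurable.smul_const _).add
      ((hk.mul hcv.measurable).aestronglyMeasurable.smul_const _)
  have hLint : Integrable fun h =>
      covector (cutoffKernel g c h * u x h) (cutoffKernel g c h * v x h) :=
    hDint.mono' hmeas (.of_forall (hbound x))
  have hsplit {G : ℝ × ℝ → ℝ} (hG : BddDeriv (k + 1) M G) (d : ℝ) :
      ∫ h, cutoffKernel g c h *
        (oscRem (k + 1) N a b θ G x h + d * oscRem (k + 1) N a b (θ + π / 2) F x h) =
      nearRem g c (k + 1) N a b θ G x + d * nearRem g c (k + 1) N a b (θ + π / 2) F x := by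
    rw [nearRem, nearRem, ← integral_const_mul, ← integral_add
      (integrable_cutoffKernel_mul_oscRem hg hc hG N a b θ x)
      ((integrable_cutoffKernel_mul_oscRem hg hc hF' N a b _ x).const_mul d)]
    exact integral_congr_ae (.of_forall fun h => by ring)
  refine (hasFDerivAt_integral_of_dominated_of_fderiv_le (𝕜 := ℝ) (s := Set.univ)
    (F := fun x h => cutoffKernel g c h * oscRem (k + 1) N a b θ F x h)
    (F' := fun x h => covector (cutoffKernel g c h * u x h) (cutoffKernel g c h * v x h))
    Filter.univ_mem (.of_forall fun y => aestronglyMeasurable_cutoffKernel_mul_oscRem hg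
      hF.contDiff.continuous _ N a b θ y)
    (integrable_cutoffKernel_mul_oscRem hg hc hF' N a b θ x) hmeas
    (.of_forall fun h y _ => hbound y h) hDint (.of_forall fun h y _ => ?_)).to_covector ?_ ?_
  · exact ((hasFDerivAt_oscRem hF.contDiff N a b θ y h).const_mul (cutoffKernel g c h)).to_covector
      (by simp [hu]) (by simp [hv])
  · rw [ContinuousLinearMap.integral_apply hLint, ← hsplit hF.pd1]
    simp [hu]
  · rw [ContinuousLinearMap.integral_apply hLint, ← hsplit hF.pd2]
    simp [hv]

lemma continuous_nearRem (hg : IsCutoff g) (hc : 0 < c) (hF : BddDeriv (k + 1) M F)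
    (N a b θ : ℝ) :
    Continuous (nearRem g c (k + 1) N a b θ F) :=
  continuous_of_dominated
    (fun x => aestronglyMeasurable_cutoffKernel_mul_oscRem hg hF.contDiff.continuous _ N a b θ x)
    (fun x => .of_forall fun h => norm_cutoffKernel_mul_le hg hc
      (by have := hF.nonneg; positivity) (abs_oscRem_le hF N a b θ x h))
    (integrable_indicator_closedBall c⁻¹ _)
    (.of_forall fun h => (continuous_oscRem_left hF.contDiff N a b θ h).const_mul _)

lemma bddDeriv_nearRem (hg : IsCutoff g) (hc : 0 < c) {N a b : ℝ} (hN : 1 ≤ N) (ha : |a| ≤ 1)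
    (hb : |b| ≤ 1) {m : ℕ} (hF : BddDeriv (k + 1 + m) M F) (θ : ℝ) :
    BddDeriv m ((2 * N) ^ m * (2 ^ (k + 3) * c⁻¹ ^ (k + 2) * M))
      (nearRem g c (k + 1) N a b θ F) := by
  induction m generalizing F θ with
  | zero =>
    exact .zero (continuous_nearRem hg hc hF N a b θ) fun x => by
      simpa using abs_nearRem_le hg hc hF N a b θ x
  | succ m ih =>
    have hM := hF.nonneg
    have hd := hasFDerivAt_nearRem hg hc (hF.of_le (l := k + 2) (by omega)) N a b θ
    set A := 2 ^ (k + 3) * c⁻¹ ^ (k + 2) * M with hA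
    have hA0 : 0 ≤ A := by positivity
    have hle {d : ℝ} (hd : |d| ≤ 1) : (2 * N) ^ m * A + |N * d| * ((2 * N) ^ m * A) ≤
        (2 * N) ^ (m + 1) * A := by
      have h1 : |N * d| ≤ N := by
        rw [abs_mul, abs_of_nonneg (by linarith)]
        exact mul_le_of_le_one_right (by linarith) hd
      calc _ = (1 + |N * d|) * ((2 * N) ^ m * A) := by ring
        _ ≤ (2 * N) * ((2 * N) ^ m * A) := by gcongr; linarith
        _ = _ := by ring
    have hF' := ih (hF.of_le (by omega)) (θ + π / 2)
    refine .succ (fun x => (hd x).differentiableAt) (fun x => ?_) ?_ ?_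
    · refine (abs_nearRem_le hg hc (hF.of_le (by omega)) N a b θ x).trans ?_
      exact le_mul_of_one_le_left hA0 (one_le_pow₀ (by linarith))
    · rw [funext fun x => (hd x).pd1_eq]
      exact ((ih hF.pd1 θ).add (hF'.const_mul (N * b))).mono (hle hb)
    · rw [funext fun x => (hd x).pd2_eq]
      exact ((ih hF.pd2 θ).add (hF'.const_mul (N * a))).mono (hle ha)

end nearRem

/-- Taylor remainder estimate for the near part of the velocity operator. -/
theorem near_part_remainder_estimate (g : ℝ → ℝ) (hg : IsCutoff g)
    (K : ℕ) (ε : ℝ) (hε : ε ∈ Set.Ioo (0 : ℝ) 1) (J : ℕ) :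
    ∃ C > 0, ∀ N : ℝ, 1 ≤ N → ∀ a b Θ₀ : ℝ, a ^ 2 + b ^ 2 = 1 →
      ∀ f : ℝ × ℝ → ℝ, ContDiff ℝ (K + J + 1 : ℕ) f →
        -- `‖f‖_{C^{K+J+1}} < ∞`
        BddAbove {y : ℝ | ∃ i j : ℕ, ∃ x : ℝ × ℝ, i + j ≤ K + J + 1 ∧ y = |pdMix i j f x|} →
        CkNorm J (fun x : ℝ × ℝ =>
            ∫ h : ℝ × ℝ, (h.1 / (h.1 ^ 2 + h.2 ^ 2))
              * (f (x + h) - ∑ i ∈ Finset.range (K + 1), ∑ j ∈ Finset.range (i + 1),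
                  pdMix (i - j) j f x * h.1 ^ (i - j) * h.2 ^ j
                    / ((Nat.factorial (i - j) : ℝ) * (Nat.factorial j : ℝ)))
              * Real.sin (N * (a * (x.2 + h.2) + b * (x.1 + h.1)) + Θ₀)
              * g (N ^ ε * rad h))
          ≤ C * N ^ ((J : ℝ) - ((K : ℝ) + 2) * ε) * CkNorm (K + J + 1) f := by
  refine ⟨2 ^ J * 2 ^ (K + 3), by positivity, fun N hN a b Θ₀ hab f hf hbdd => ?_⟩
  have hN0 : 0 < N := by linarith
  have hF : BddDeriv (K + 1 + J) (CkNorm (K + J + 1) f) f :=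
    ⟨hf.of_le (by norm_cast; omega), fun i j x h => le_csSup hbdd ⟨i, j, x, by omega, rfl⟩⟩
  have ha : |a| ≤ 1 := abs_le_one_iff_mul_self_le_one.2 (by nlinarith [sq_nonneg b])
  have hb : |b| ≤ 1 := abs_le_one_iff_mul_self_le_one.2 (by nlinarith [sq_nonneg a])
  have hR := bddDeriv_nearRem hg (Real.rpow_pos_of_pos hN0 ε) hN ha hb hF Θ₀
  have hpow : N ^ J * (N ^ ε)⁻¹ ^ (K + 2) = N ^ ((J : ℝ) - ((K : ℝ) + 2) * ε) := by
    rw [Real.rpow_sub hN0, Real.rpow_natCast, mul_comm ((K : ℝ) + 2), Real.rpow_mul hN0.le,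
      inv_pow, div_eq_mul_inv]
    norm_cast
  have hconst : 2 ^ J * 2 ^ (K + 3) * N ^ ((J : ℝ) - ((K : ℝ) + 2) * ε) * CkNorm (K + J + 1) f =
      (2 * N) ^ J * (2 ^ (K + 3) * (N ^ ε)⁻¹ ^ (K + 2) * CkNorm (K + J + 1) f) := by
    rw [← hpow]
    ring
  rw [hconst]
  refine csSup_le ⟨_, 0, 0, 0, by simp, rfl⟩ ?_
  rintro _ ⟨i, j, x, hij, rfl⟩
  refine (congrArg (fun G => |pdMix i j G x|) (funext fun x => ?_)).trans_le
    (hR.abs_le i j x hij)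
  refine integral_congr_ae (.of_forall fun h => ?_)
  simp only [cutoffKernel, oscRem, taylorRem, taylorTerm_eq_sum_range]
  ring
end

section
/- Convergence of the kernel moment integrals: fix ε ∈ (0,1) and integers 0 ≤ j ≤ i. For every A > 1 there exists a constant C > 0, depending only on A, i, j, ε and g but not on (a,b), such that for all a, b ∈ ℝ with a² + b² = 1 and all N₂ ≥ N₁ ≥ 1, |T^{i,j,s}_{N₁} − T^{i,j,s}_{N₂}| ≤ C N₁^{−A} and |T^{i,j,c}_{N₁} − T^{i,j,c}_{N₂}| ≤ C N₁^{−A}. Consequently, the limits c^s_{i,j}(a,b) = lim_{N→∞} T^{i,j,s}_N and c^c_{i,j}(a,b) = lim_{N→∞} T^{i,j,c}_N exist, satisfy |c^s_{i,j}(a,b) − T^{i,j,s}_N| ≤ 2C N^{−A} and |c^c_{i,j}(a,b) − T^{i,j,c}_N| ≤ 2C N^{−A} for all N ≥ 1, and there exists a constant C_i, independent of (a,b), with |c^s_{i,j}(a,b)| ≤ C_i and |c^c_{i,j}(a,b)| ≤ C_i. -/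
open MeasureTheory Real Filter

/-- The kernel moment integral `T^{i,j,s}_N` (with `cos(a h₂ + b h₁)`). -/
noncomputable def Tijs (g : ℝ → ℝ) (ε a b : ℝ) (i j : ℕ) (N : ℝ) : ℝ :=
  ∫ h : ℝ × ℝ, (h.1 / (h.1 ^ 2 + h.2 ^ 2))
    * (h.1 ^ (i - j) * h.2 ^ j / ((Nat.factorial (i - j) : ℝ) * (Nat.factorial j : ℝ)))
    * Real.cos (a * h.2 + b * h.1) * g (N ^ (ε - 1) * rad h)

/-- The kernel moment integral `T^{i,j,c}_N` (with `sin(a h₂ + b h₁)`). -/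
noncomputable def Tijc (g : ℝ → ℝ) (ε a b : ℝ) (i j : ℕ) (N : ℝ) : ℝ :=
  ∫ h : ℝ × ℝ, (h.1 / (h.1 ^ 2 + h.2 ^ 2))
    * (h.1 ^ (i - j) * h.2 ^ j / ((Nat.factorial (i - j) : ℝ) * (Nat.factorial j : ℝ)))
    * Real.sin (a * h.2 + b * h.1) * g (N ^ (ε - 1) * rad h)

/-- The phase-shifted plane wave `cos (R (a h₂ + b h₁) + θ)`. -/
noncomputable def planeWave (a b θ R : ℝ) (h : ℝ × ℝ) : ℝ :=
  Real.cos (R * (a * h.2 + b * h.1) + θ)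

lemma continuous_planeWave (a b θ R : ℝ) : Continuous (planeWave a b θ R) := by
  unfold planeWave; fun_prop

lemma abs_planeWave_le_one (a b θ R : ℝ) (h : ℝ × ℝ) : |planeWave a b θ R h| ≤ 1 :=
  Real.abs_cos_le_one _

lemma hasFDerivAt_planeWave (a b θ R : ℝ) (h : ℝ × ℝ) :
    HasFDerivAt (planeWave a b θ R)
      (-Real.sin (R * (a * h.2 + b * h.1) + θ) •
        (R • (a • ContinuousLinearMap.snd ℝ ℝ ℝ + b • ContinuousLinearMap.fst ℝ ℝ ℝ))) h := by
  have h2 : HasFDerivAt (fun h : ℝ × ℝ => R * (a * h.2 + b * h.1) + θ)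
      (R • (a • ContinuousLinearMap.snd ℝ ℝ ℝ + b • ContinuousLinearMap.fst ℝ ℝ ℝ)) h :=
    (((hasFDerivAt_snd.const_mul a).add (hasFDerivAt_fst.const_mul b)).const_mul R).add_const θ
  exact h2.cos

lemma fderiv_planeWave_apply {a b : ℝ} (hab : a ^ 2 + b ^ 2 = 1) (θ R : ℝ) (h : ℝ × ℝ) :
    fderiv ℝ (planeWave a b θ R) h (b, a) = R * planeWave a b (θ + π / 2) R h := by
  have h1 : a * a + b * b = 1 := by linarith
  rw [(hasFDerivAt_planeWave a b θ R h).fderiv, planeWave, ← add_assoc, Real.cos_add_pi_div_two]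
  simp only [smul_apply, add_apply, ContinuousLinearMap.coe_fst', ContinuousLinearMap.coe_snd',
    smul_eq_mul]
  linear_combination (-(R * Real.sin (R * (a * h.2 + b * h.1) + θ))) * h1

lemma integrable_mul_planeWave {f : ℝ × ℝ → ℝ} (hf : Integrable f) (a b θ R : ℝ) :
    Integrable (fun h => f h * planeWave a b θ R h) :=
  hf.mul_bdd (c := 1) (continuous_planeWave a b θ R).aestronglyMeasurable
    (ae_of_all _ fun h => by simpa using abs_planeWave_le_one a b θ R h)

lemma abs_integral_mul_planeWave_le {f : ℝ × ℝ → ℝ} (hf : Integrable f) (a b θ R : ℝ) :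
    |∫ h, f h * planeWave a b θ R h| ≤ ∫ h, |f h| := by
  refine (abs_integral_le_integral_abs).trans ?_
  refine integral_mono (integrable_mul_planeWave hf a b θ R).abs hf.abs fun h => ?_
  simp only [abs_mul]
  exact mul_le_of_le_one_right (abs_nonneg _) (abs_planeWave_le_one a b θ R h)

/-- Oscillatory integrals with smooth compactly supported amplitude decay faster than any power
of the frequency, uniformly in the direction and in the phase. -/
lemma exists_abs_integral_mul_planeWave_le (m : ℕ) {f : ℝ × ℝ → ℝ}
    (hf : ContDiff ℝ (⊤ : ℕ∞) f) (hc : HasCompactSupport f) :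
    ∃ C : ℝ, 0 ≤ C ∧ ∀ a b θ R : ℝ, a ^ 2 + b ^ 2 = 1 → 0 < R →
      |∫ h, f h * planeWave a b θ R h| ≤ C / R ^ m := by
  induction m generalizing f with
  | zero =>
    refine ⟨∫ h, |f h|, integral_nonneg fun _ => abs_nonneg _, fun a b θ R _ _ => ?_⟩
    simpa using abs_integral_mul_planeWave_le (hf.continuous.integrable_of_hasCompactSupport hc) ..
  | succ m ih =>
    have hd (v : ℝ × ℝ) : ContDiff ℝ (⊤ : ℕ∞) (fun h => fderiv ℝ f h v) :=
      (hf.fderiv_right (by simp)).clm_apply contDiff_const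
    have hdc (v : ℝ × ℝ) : HasCompactSupport (fun h => fderiv ℝ f h v) :=
      hc.fderiv_apply ℝ v
    have hdi (v : ℝ × ℝ) : Integrable (fun h => fderiv ℝ f h v) :=
      (hd v).continuous.integrable_of_hasCompactSupport (hdc v)
    obtain ⟨C₁, hC₁, h₁⟩ := ih (hd (1, 0)) (hdc (1, 0))
    obtain ⟨C₂, hC₂, h₂⟩ := ih (hd (0, 1)) (hdc (0, 1))
    refine ⟨C₁ + C₂, by positivity, fun a b θ R hab hR => ?_⟩
    have hfi := hf.continuous.integrable_of_hasCompactSupport hc (μ := volume)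
    have key := integral_mul_fderiv_eq_neg_fderiv_mul_of_integrable (μ := volume) (f := f)
      (g := planeWave a b (θ - π / 2) R) (v := (b, a))
      (integrable_mul_planeWave (hdi _) ..)
      (by
        simp only [fderiv_planeWave_apply hab]
        convert (integrable_mul_planeWave hfi a b (θ - π / 2 + π / 2) R).const_mul R using 2
        ring)
      (integrable_mul_planeWave hfi ..)
      (fun x _ => (hf.differentiable (by simp)).differentiableAt)
      (fun x _ => (hasFDerivAt_planeWave ..).differentiableAt)
    simp only [fderiv_planeWave_apply hab, sub_add_cancel] at key
    have hsplit (h : ℝ × ℝ) : fderiv ℝ f h (b, a) =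
        b * fderiv ℝ f h (1, 0) + a * fderiv ℝ f h (0, 1) := by
      have : ((b, a) : ℝ × ℝ) = b • ((1, 0) : ℝ × ℝ) + a • ((0, 1) : ℝ × ℝ) := by simp
      rw [this, map_add, map_smul, map_smul, smul_eq_mul, smul_eq_mul]
    have e1 : (∫ h, f h * (R * planeWave a b θ R h)) = R * ∫ h, f h * planeWave a b θ R h := by
      rw [← integral_const_mul]; congr 1; ext h; ring
    have e2 : (∫ h, fderiv ℝ f h (b, a) * planeWave a b (θ - π / 2) R h) =
        b * (∫ h, fderiv ℝ f h (1, 0) * planeWave a b (θ - π / 2) R h) +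
        a * ∫ h, fderiv ℝ f h (0, 1) * planeWave a b (θ - π / 2) R h := by
      rw [← integral_const_mul, ← integral_const_mul, ← integral_add
        ((integrable_mul_planeWave (hdi _) ..).const_mul _)
        ((integrable_mul_planeWave (hdi _) ..).const_mul _)]
      congr 1; ext h; rw [hsplit]; ring
    rw [e1, e2] at key
    have ha : |a| ≤ 1 := abs_le_one_iff_mul_self_le_one.2 (by nlinarith)
    have hb : |b| ≤ 1 := abs_le_one_iff_mul_self_le_one.2 (by nlinarith)
    have hbound : R * |∫ h, f h * planeWave a b θ R h| ≤ C₁ / R ^ m + C₂ / R ^ m := by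
      rw [← abs_of_pos hR, ← abs_mul, abs_of_pos hR, key, abs_neg]
      refine (abs_add_le _ _).trans (add_le_add ?_ ?_) <;> rw [abs_mul]
      · exact (mul_le_of_le_one_left (abs_nonneg _) hb).trans (h₁ a b _ R hab hR)
      · exact (mul_le_of_le_one_left (abs_nonneg _) ha).trans (h₂ a b _ R hab hR)
    rw [pow_succ, ← div_div, le_div_iff₀ hR, add_div, mul_comm]
    exact hbound

/-- The homogeneous kernel `h₁ / |h|² · h₁^(i-j) h₂^j / ((i-j)! j!)`. -/
noncomputable def momentKernel (i j : ℕ) (h : ℝ × ℝ) : ℝ :=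
  (h.1 / (h.1 ^ 2 + h.2 ^ 2))
    * (h.1 ^ (i - j) * h.2 ^ j / ((Nat.factorial (i - j) : ℝ) * (Nat.factorial j : ℝ)))

lemma continuous_rad : Continuous rad := by unfold rad; fun_prop

lemma rad_nonneg (h : ℝ × ℝ) : 0 ≤ rad h := Real.sqrt_nonneg _

lemma rad_smul {s : ℝ} (hs : 0 ≤ s) (h : ℝ × ℝ) : rad (s • h) = s * rad h := by
  have : (s • h).1 ^ 2 + (s • h).2 ^ 2 = s ^ 2 * (h.1 ^ 2 + h.2 ^ 2) := by
    simp only [Prod.smul_fst, Prod.smul_snd, smul_eq_mul]; ring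
  rw [rad, this, Real.sqrt_mul (sq_nonneg s), Real.sqrt_sq hs, rad]

lemma momentKernel_smul {i j : ℕ} (hij : j ≤ i) {s : ℝ} (hs : s ≠ 0) (h : ℝ × ℝ) :
    momentKernel i j (s • h) * s = s ^ i * momentKernel i j h := by
  have e : (s * h.1) ^ 2 + (s * h.2) ^ 2 = s ^ 2 * (h.1 ^ 2 + h.2 ^ 2) := by ring
  have e3 : s ^ i = s ^ (i - j) * s ^ j := by rw [← pow_add, Nat.sub_add_cancel hij]
  simp only [momentKernel, Prod.smul_fst, Prod.smul_snd, smul_eq_mul, e]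
  simp only [mul_pow, e3]
  rcases eq_or_ne (h.1 ^ 2 + h.2 ^ 2) 0 with h0 | h0
  · simp [h0]
  · field_simp

lemma measurable_momentKernel (i j : ℕ) : Measurable (momentKernel i j) := by
  unfold momentKernel; fun_prop

lemma sq_add_sq_pos_of_ne_zero {h : ℝ × ℝ} (hh : h ≠ 0) : 0 < h.1 ^ 2 + h.2 ^ 2 := by
  rcases eq_or_ne h.1 0 with h1 | h1
  · have h2 : h.2 ≠ 0 := fun h2 => hh (Prod.ext h1 h2)
    positivity
  · positivity

lemma locallyIntegrable_fst_div_sq_add_sq :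
    LocallyIntegrable (fun h : ℝ × ℝ => h.1 / (h.1 ^ 2 + h.2 ^ 2)) := by
  refine locallyIntegrable_of_norm_le_rpow (C := 1) (α := 1) (by simp) (by simp)
    (ae_of_all _ fun h => ?_) (Measurable.aestronglyMeasurable (by fun_prop))
  rcases eq_or_ne h 0 with rfl | hh
  · simp
  have hp := sq_add_sq_pos_of_ne_zero hh
  have hn : 0 < ‖h‖ := norm_pos_iff.2 hh
  have h1 : |h.1| ≤ ‖h‖ := norm_fst_le h
  have h2 : ‖h‖ ^ 2 ≤ h.1 ^ 2 + h.2 ^ 2 := (Real.le_sqrt (norm_nonneg _) hp.le).1 (norm_le_rad h)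
  rw [one_mul, Real.rpow_neg_one, norm_div, Real.norm_eq_abs, Real.norm_eq_abs, abs_of_pos hp,
    div_le_iff₀ hp, ← div_eq_inv_mul, le_div_iff₀ hn]
  nlinarith

lemma integrableOn_momentKernel (i j : ℕ) (ρ : ℝ) :
    IntegrableOn (momentKernel i j) (Metric.closedBall 0 ρ) := by
  have hK := isCompact_closedBall (0 : ℝ × ℝ) ρ
  exact (locallyIntegrable_fst_div_sq_add_sq.integrableOn_isCompact hK).mul_continuousOn
    (by fun_prop) hK

lemma contDiffAt_momentKernel (i j : ℕ) {h : ℝ × ℝ} (hh : h ≠ 0) :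
    ContDiffAt ℝ (⊤ : ℕ∞) (momentKernel i j) h := by
  unfold momentKernel
  have := (sq_add_sq_pos_of_ne_zero hh).ne'
  fun_prop (disch := assumption)

lemma contDiffAt_rad {h : ℝ × ℝ} (hh : h ≠ 0) : ContDiffAt ℝ (⊤ : ℕ∞) rad h := by
  unfold rad
  exact ContDiffAt.sqrt (by fun_prop) (sq_add_sq_pos_of_ne_zero hh).ne'

namespace IsCutoff

variable {g : ℝ → ℝ}

lemma abs_le_one_s6 (hg : IsCutoff g) {r : ℝ} (hr : 0 ≤ r) : |g r| ≤ 1 := by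
  obtain ⟨-, hanti, h1, h0⟩ := hg
  rw [abs_le]
  refine ⟨?_, (hanti Set.self_mem_Ici hr hr).trans_eq (h1 0 (by norm_num))⟩
  have := hanti hr (le_max_of_le_left hr : (0 : ℝ) ≤ max r 1) (le_max_left r 1)
  rw [h0 _ (le_max_right r 1)] at this
  linarith

lemma deriv_eq_zero_of_lt (hg : IsCutoff g) {r : ℝ} (hr : r < 1 / 2) : deriv g r = 0 := by
  have : g =ᶠ[nhds r] fun _ => 1 := by
    filter_upwards [Iio_mem_nhds hr] with x hx using hg.2.2.1 x (le_of_lt hx)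
  rw [this.deriv_eq, deriv_const]

lemma deriv_eq_zero_of_gt (hg : IsCutoff g) {r : ℝ} (hr : 1 < r) : deriv g r = 0 := by
  have : g =ᶠ[nhds r] fun _ => 0 := by
    filter_upwards [Ioi_mem_nhds hr] with x hx using hg.2.2.2 x (le_of_lt hx)
  rw [this.deriv_eq, deriv_const]

lemma contDiff_deriv (hg : IsCutoff g) : ContDiff ℝ (⊤ : ℕ∞) (deriv g) :=
  (contDiff_infty_iff_deriv.1 hg.1).2

lemma exists_abs_deriv_le (hg : IsCutoff g) : ∃ M, ∀ r, |deriv g r| ≤ M :=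
  (HasCompactSupport.intro (isCompact_Icc (a := 1 / 2) (b := 1)) fun r hr => by
    by_cases h : r < 1 / 2
    · exact hg.deriv_eq_zero_of_lt h
    · exact hg.deriv_eq_zero_of_gt (not_le.1 fun h' => hr ⟨not_lt.1 h, h'⟩)
    ).exists_bound_of_continuous hg.contDiff_deriv.continuous

end IsCutoff

/-- The amplitude `K(u) |u| g'(|u|)` produced by differentiating the cutoff in its scale. -/
noncomputable def scaleAmplitude (g : ℝ → ℝ) (i j : ℕ) (h : ℝ × ℝ) : ℝ :=
  momentKernel i j h * (rad h * deriv g (rad h))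

lemma contDiff_scaleAmplitude {g : ℝ → ℝ} (hg : IsCutoff g) (i j : ℕ) :
    ContDiff ℝ (⊤ : ℕ∞) (scaleAmplitude g i j) := by
  rw [contDiff_iff_contDiffAt]
  intro h
  rcases eq_or_ne h 0 with rfl | hh
  · have : scaleAmplitude g i j =ᶠ[nhds 0] fun _ => 0 := by
      filter_upwards [continuous_rad.continuousAt.preimage_mem_nhds
        (Iio_mem_nhds (show rad 0 < 1 / 2 by simp [rad]))] with x hx
      simp [scaleAmplitude, hg.deriv_eq_zero_of_lt hx]
    exact contDiffAt_const.congr_of_eventuallyEq this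
  · exact (contDiffAt_momentKernel i j hh).mul ((contDiffAt_rad hh).mul
      (hg.contDiff_deriv.contDiffAt.comp h (contDiffAt_rad hh)))

lemma hasCompactSupport_scaleAmplitude {g : ℝ → ℝ} (hg : IsCutoff g) (i j : ℕ) :
    HasCompactSupport (scaleAmplitude g i j) := by
  refine HasCompactSupport.intro (isCompact_closedBall (0 : ℝ × ℝ) 1) fun h hh => ?_
  rw [mem_closedBall_zero_iff, not_le] at hh
  simp [scaleAmplitude, hg.deriv_eq_zero_of_gt (hh.trans_le (norm_le_rad h))]

/-- The kernel moment integral with phase shift `θ`, cut off at scale `s⁻¹`. -/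
noncomputable def phaseMoment (g : ℝ → ℝ) (i j : ℕ) (a b θ s : ℝ) : ℝ :=
  ∫ h, momentKernel i j h * planeWave a b θ 1 h * g (s * rad h)

lemma Tijs_eq_phaseMoment (g : ℝ → ℝ) (ε a b : ℝ) (i j : ℕ) (N : ℝ) :
    Tijs g ε a b i j N = phaseMoment g i j a b 0 (N ^ (ε - 1)) := by
  simp [Tijs, phaseMoment, momentKernel, planeWave]

lemma Tijc_eq_phaseMoment (g : ℝ → ℝ) (ε a b : ℝ) (i j : ℕ) (N : ℝ) :
    Tijc g ε a b i j N = phaseMoment g i j a b (-(π / 2)) (N ^ (ε - 1)) := by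
  simp [Tijc, phaseMoment, momentKernel, planeWave, ← sub_eq_add_neg, Real.cos_sub_pi_div_two]

section

variable {g : ℝ → ℝ} {i j : ℕ}

/-- Pointwise domination used for all the integrands occurring below. -/
lemma abs_mul_le_indicator {ρ B w c : ℝ} {h : ℝ × ℝ} (hw : |w| ≤ 1) (hB : |c| ≤ B)
    (hc : ρ < rad h → c = 0) :
    |momentKernel i j h * w * c| ≤
      (Metric.closedBall 0 ρ).indicator (fun h => B * |momentKernel i j h|) h := by
  by_cases hh : rad h ≤ ρ
  · rw [Set.indicator_of_mem (by simpa using (norm_le_rad h).trans hh), abs_mul, abs_mul,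
      mul_comm B]
    exact mul_le_mul (mul_le_of_le_one_right (abs_nonneg _) hw) hB (abs_nonneg _) (abs_nonneg _)
  · rw [hc (not_le.1 hh), mul_zero, abs_zero]
    exact Set.indicator_nonneg (fun h _ => mul_nonneg ((abs_nonneg c).trans hB) (abs_nonneg _)) h

lemma integrable_indicator_abs_momentKernel (i j : ℕ) (ρ B : ℝ) :
    Integrable ((Metric.closedBall 0 ρ).indicator fun h => B * |momentKernel i j h|) :=
  IntegrableOn.integrable_indicator (((integrableOn_momentKernel i j ρ).abs).const_mul B)
    Metric.isClosed_closedBall.measurableSet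

lemma IsCutoff.eq_zero_of_inv_lt (hg : IsCutoff g) {s r : ℝ} (hs : 0 < s) (hr : s⁻¹ < r) :
    g (s * r) = 0 :=
  hg.2.2.2 _ ((inv_le_iff_one_le_mul₀' hs).1 hr.le)

lemma abs_phaseMoment_integrand_le (hg : IsCutoff g) {s : ℝ} (hs : 0 < s) (a b θ : ℝ)
    (h : ℝ × ℝ) :
    |momentKernel i j h * planeWave a b θ 1 h * g (s * rad h)| ≤
      (Metric.closedBall 0 s⁻¹).indicator (fun h => 1 * |momentKernel i j h|) h :=
  abs_mul_le_indicator (abs_planeWave_le_one ..)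
    (hg.abs_le_one_s6 (mul_nonneg hs.le (rad_nonneg h))) (hg.eq_zero_of_inv_lt hs)

lemma aestronglyMeasurable_phaseMoment_integrand {c : ℝ × ℝ → ℝ} (hc : Continuous c)
    (a b θ : ℝ) :
    AEStronglyMeasurable (fun h => momentKernel i j h * planeWave a b θ 1 h * c h) :=
  (((measurable_momentKernel i j).mul (continuous_planeWave a b θ 1).measurable).mul
    hc.measurable).aestronglyMeasurable

lemma abs_phaseMoment_le (hg : IsCutoff g) {s : ℝ} (hs : 0 < s) (a b θ : ℝ) :
    |phaseMoment g i j a b θ s| ≤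
      ∫ h, (Metric.closedBall 0 s⁻¹).indicator (fun h => 1 * |momentKernel i j h|) h :=
  norm_integral_le_of_norm_le
    (f := fun h => momentKernel i j h * planeWave a b θ 1 h * g (s * rad h))
    (integrable_indicator_abs_momentKernel i j s⁻¹ 1)
    (ae_of_all _ fun h => abs_phaseMoment_integrand_le hg hs a b θ h)

lemma hasDerivAt_phaseMoment (hg : IsCutoff g) {s : ℝ} (hs : 0 < s) (a b θ : ℝ) :
    HasDerivAt (phaseMoment g i j a b θ)
      (∫ h, momentKernel i j h * planeWave a b θ 1 h * (rad h * deriv g (s * rad h))) s := by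
  obtain ⟨M, hM⟩ := hg.exists_abs_deriv_le
  have hM0 : 0 ≤ M := (abs_nonneg _).trans (hM 0)
  have hs2 : 0 < s / 2 := half_pos hs
  have hgc := hg.1.continuous
  have hgc' := hg.contDiff_deriv.continuous
  have hr := continuous_rad
  refine (hasDerivAt_integral_of_dominated_loc_of_deriv_le (Ioi_mem_nhds (half_lt_self hs))
    (F := fun s h => momentKernel i j h * planeWave a b θ 1 h * g (s * rad h))
    (F' := fun s h => momentKernel i j h * planeWave a b θ 1 h * (rad h * deriv g (s * rad h)))
    (bound := (Metric.closedBall 0 (s / 2)⁻¹).indicator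
      fun h => ((s / 2)⁻¹ * M) * |momentKernel i j h|)
    (.of_forall fun x => aestronglyMeasurable_phaseMoment_integrand (by fun_prop) a b θ)
    ((integrable_indicator_abs_momentKernel i j s⁻¹ 1).mono'
      (aestronglyMeasurable_phaseMoment_integrand (by fun_prop) a b θ)
      (ae_of_all _ fun h => abs_phaseMoment_integrand_le hg hs a b θ h))
    (aestronglyMeasurable_phaseMoment_integrand (by fun_prop) a b θ)
    (ae_of_all _ fun h x hx => ?_)
    (integrable_indicator_abs_momentKernel i j _ _)
    (ae_of_all _ fun h x hx => ?_)).2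
  · have hvanish : (s / 2)⁻¹ < rad h → rad h * deriv g (x * rad h) = 0 := fun hlt => by
      have h1 : 1 < x * rad h := by
        calc 1 < s / 2 * rad h := (inv_lt_iff_one_lt_mul₀' hs2).1 hlt
          _ ≤ x * rad h := mul_le_mul_of_nonneg_right (le_of_lt hx) (rad_nonneg h)
      rw [hg.deriv_eq_zero_of_gt h1, mul_zero]
    refine abs_mul_le_indicator (abs_planeWave_le_one ..) ?_ hvanish
    by_cases hlt : (s / 2)⁻¹ < rad h
    · rw [hvanish hlt, abs_zero]; positivity
    · rw [abs_mul, abs_of_nonneg (rad_nonneg h)]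
      exact mul_le_mul (not_lt.1 hlt) (hM _) (abs_nonneg _) (by positivity)
  · have hd : HasDerivAt (fun x => g (x * rad h)) (deriv g (x * rad h) * (1 * rad h)) x :=
      ((hg.1.differentiable (by simp)).differentiableAt.hasDerivAt).comp x
        ((hasDerivAt_id x).mul_const (rad h))
    rw [one_mul, mul_comm] at hd
    exact hd.const_mul (momentKernel i j h * planeWave a b θ 1 h)

/-- Rescaling by `s` turns the scale derivative into an oscillatory integral with frequency
`s⁻¹`. -/
lemma pow_mul_integral_deriv_eq (hij : j ≤ i) {s : ℝ} (hs : 0 < s) (a b θ : ℝ) :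
    s ^ i * ∫ h, momentKernel i j h * planeWave a b θ 1 h * (rad h * deriv g (s * rad h)) =
      (s ^ 2)⁻¹ * ∫ h, scaleAmplitude g i j h * planeWave a b θ s⁻¹ h := by
  have h := Measure.integral_comp_smul (volume : Measure (ℝ × ℝ))
    (fun h => scaleAmplitude g i j h * planeWave a b θ s⁻¹ h) s
  rw [abs_of_nonneg (by positivity)] at h
  simp only [Module.finrank_prod, Module.finrank_self, Nat.reduceAdd, smul_eq_mul] at h
  rw [← h, ← integral_const_mul]
  congr 1
  ext u
  have hp : planeWave a b θ s⁻¹ (s • u) = planeWave a b θ 1 u := by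
    simp only [planeWave, Prod.smul_fst, Prod.smul_snd, smul_eq_mul]
    congr 2
    field_simp
  rw [hp, scaleAmplitude, rad_smul hs.le]
  linear_combination (-(planeWave a b θ 1 u * rad u * deriv g (s * rad u))) *
    momentKernel_smul hij hs.ne' u

lemma exists_abs_deriv_phaseMoment_le (hg : IsCutoff g) (hij : j ≤ i) (m : ℕ) :
    ∃ C : ℝ, 0 ≤ C ∧ ∀ a b θ s : ℝ, a ^ 2 + b ^ 2 = 1 → 0 < s →
      |∫ h, momentKernel i j h * planeWave a b θ 1 h * (rad h * deriv g (s * rad h))| ≤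
        C * s ^ m := by
  obtain ⟨C, hC, hbound⟩ := exists_abs_integral_mul_planeWave_le (m + i + 2)
    (contDiff_scaleAmplitude hg i j) (hasCompactSupport_scaleAmplitude hg i j)
  refine ⟨C, hC, fun a b θ s hab hs => ?_⟩
  have h1 := hbound a b θ s⁻¹ hab (inv_pos.2 hs)
  rw [inv_pow, div_inv_eq_mul] at h1
  refine le_of_mul_le_mul_left ?_ (pow_pos hs i)
  rw [← abs_of_pos (pow_pos hs i), ← abs_mul, pow_mul_integral_deriv_eq hij hs, abs_mul,
    abs_of_pos (pow_pos hs i), abs_of_pos (by positivity : 0 < (s ^ 2)⁻¹),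
    inv_mul_le_iff₀ (by positivity)]
  exact h1.trans_eq (by ring)

lemma exists_abs_phaseMoment_sub_le (hg : IsCutoff g) (hij : j ≤ i) (m : ℕ) :
    ∃ C : ℝ, 0 ≤ C ∧ ∀ a b θ s t : ℝ, a ^ 2 + b ^ 2 = 1 → 0 < t → t ≤ s → s ≤ 1 →
      |phaseMoment g i j a b θ s - phaseMoment g i j a b θ t| ≤ C * s ^ m := by
  obtain ⟨C, hC, hbound⟩ := exists_abs_deriv_phaseMoment_le hg hij m
  refine ⟨C, hC, fun a b θ s t hab ht hts hs => ?_⟩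
  have h := Convex.norm_image_sub_le_of_norm_hasDerivWithin_le
    (f := phaseMoment g i j a b θ) (s := Set.Icc t s) (C := C * s ^ m)
    (fun x hx => (hasDerivAt_phaseMoment hg (ht.trans_le hx.1) a b θ).hasDerivWithinAt)
    (fun x hx => (hbound a b θ x hab (ht.trans_le hx.1)).trans
      (mul_le_mul_of_nonneg_left (pow_le_pow_left₀ (ht.le.trans hx.1) hx.2 m) hC))
    (convex_Icc t s) (Set.left_mem_Icc.2 hts) (Set.right_mem_Icc.2 hts)
  refine h.trans (mul_le_of_le_one_right (mul_nonneg hC (pow_nonneg (ht.le.trans hts) m)) ?_)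
  rw [Real.norm_eq_abs, abs_of_nonneg (sub_nonneg.2 hts)]
  linarith

/-- Decay of the increments in the scale `N`, faster than any power. -/
lemma exists_abs_phaseMoment_rpow_sub_le (hg : IsCutoff g) (hij : j ≤ i) {ε : ℝ} (hε : ε < 1)
    (A : ℝ) :
    ∃ C > 0, ∀ a b θ N₁ N₂ : ℝ, a ^ 2 + b ^ 2 = 1 → 1 ≤ N₁ → N₁ ≤ N₂ →
      |phaseMoment g i j a b θ (N₁ ^ (ε - 1)) - phaseMoment g i j a b θ (N₂ ^ (ε - 1))| ≤
        C * N₁ ^ (-A) := by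
  obtain ⟨m, hm⟩ := exists_nat_ge (A / (1 - ε))
  obtain ⟨C, hC, hbound⟩ := exists_abs_phaseMoment_sub_le hg hij m
  refine ⟨C + 1, by positivity, fun a b θ N₁ N₂ hab h1 h12 => ?_⟩
  have hN : 0 < N₁ := one_pos.trans_le h1
  refine (hbound a b θ _ _ hab (Real.rpow_pos_of_pos (hN.trans_le h12) _)
    (Real.rpow_le_rpow_of_nonpos hN h12 (by linarith))
    (Real.rpow_le_one_of_one_le_of_nonpos h1 (by linarith))).trans ?_
  rw [div_le_iff₀ (by linarith)] at hm
  rw [← Real.rpow_natCast, ← Real.rpow_mul hN.le]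
  exact mul_le_mul (by linarith) (Real.rpow_le_rpow_of_exponent_le h1 (by linarith))
    (by positivity) (by positivity)

lemma exists_tendsto_phaseMoment (hg : IsCutoff g) (hij : j ≤ i) {ε : ℝ} (hε : ε < 1)
    {a b : ℝ} (hab : a ^ 2 + b ^ 2 = 1) (θ : ℝ) :
    ∃ c, Tendsto (fun N : ℝ => phaseMoment g i j a b θ (N ^ (ε - 1))) atTop (nhds c) := by
  obtain ⟨C, hC, hbound⟩ := exists_abs_phaseMoment_rpow_sub_le hg hij hε 1
  have hdecay : Tendsto (fun N : ℝ => C * (max N 1) ^ (-1 : ℝ)) atTop (nhds 0) := by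
    simpa using ((tendsto_rpow_neg_atTop one_pos).comp
      (tendsto_atTop_mono (fun N => le_max_left N 1) tendsto_id)).const_mul C
  have hcauchy : CauchySeq fun N : ℝ => phaseMoment g i j a b θ ((max N 1) ^ (ε - 1)) :=
    cauchySeq_of_le_tendsto_0' _ (fun n m hnm => hbound a b θ _ _ hab (le_max_right n 1)
      (max_le_max_right 1 hnm)) hdecay
  obtain ⟨c, hc⟩ := cauchySeq_tendsto_of_complete hcauchy
  refine ⟨c, hc.congr' ?_⟩
  filter_upwards [eventually_ge_atTop 1] with N hN
  rw [max_eq_left hN]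

end

/-- Convergence of the kernel moment integrals and uniform bounds for their limits. -/
theorem kernel_moment_convergence (g : ℝ → ℝ) (hg : IsCutoff g)
    (ε : ℝ) (hε : ε ∈ Set.Ioo (0 : ℝ) 1) (i j : ℕ) (hij : j ≤ i) :
    ∃ cs cc : ℝ → ℝ → ℝ,
      -- the limits exist
      (∀ a b : ℝ, a ^ 2 + b ^ 2 = 1 →
        Tendsto (fun N : ℝ => Tijs g ε a b i j N) atTop (nhds (cs a b)) ∧
        Tendsto (fun N : ℝ => Tijc g ε a b i j N) atTop (nhds (cc a b))) ∧
      -- quantitative Cauchy estimates and rate of convergence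
      (∀ A : ℝ, 1 < A → ∃ C > 0, ∀ a b : ℝ, a ^ 2 + b ^ 2 = 1 →
        (∀ N₁ N₂ : ℝ, 1 ≤ N₁ → N₁ ≤ N₂ →
          |Tijs g ε a b i j N₁ - Tijs g ε a b i j N₂| ≤ C * N₁ ^ (-A) ∧
          |Tijc g ε a b i j N₁ - Tijc g ε a b i j N₂| ≤ C * N₁ ^ (-A)) ∧
        (∀ N : ℝ, 1 ≤ N →
          |cs a b - Tijs g ε a b i j N| ≤ 2 * C * N ^ (-A) ∧
          |cc a b - Tijc g ε a b i j N| ≤ 2 * C * N ^ (-A))) ∧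
      -- uniform bound independent of `(a,b)`
      (∃ Ci > 0, ∀ a b : ℝ, a ^ 2 + b ^ 2 = 1 → |cs a b| ≤ Ci ∧ |cc a b| ≤ Ci) := by
  let c (θ a b : ℝ) : ℝ :=
    limUnder atTop fun N : ℝ => phaseMoment g i j a b θ (N ^ (ε - 1))
  have hlim (θ a b : ℝ) (hab : a ^ 2 + b ^ 2 = 1) :
      Tendsto (fun N : ℝ => phaseMoment g i j a b θ (N ^ (ε - 1))) atTop (nhds (c θ a b)) :=
    tendsto_nhds_limUnder (exists_tendsto_phaseMoment hg hij hε.2 hab θ)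
  have hrate {A C : ℝ} (hbound : ∀ a b θ N₁ N₂ : ℝ, a ^ 2 + b ^ 2 = 1 → 1 ≤ N₁ → N₁ ≤ N₂ →
      |phaseMoment g i j a b θ (N₁ ^ (ε - 1)) - phaseMoment g i j a b θ (N₂ ^ (ε - 1))| ≤
        C * N₁ ^ (-A)) (θ a b N : ℝ) (hab : a ^ 2 + b ^ 2 = 1) (hN : 1 ≤ N) :
      |c θ a b - phaseMoment g i j a b θ (N ^ (ε - 1))| ≤ C * N ^ (-A) := by
    refine le_of_tendsto ((hlim θ a b hab).sub_const _).abs ?_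
    filter_upwards [eventually_ge_atTop N] with N' hN'
    rw [abs_sub_comm]
    exact hbound a b θ N N' hab hN hN'
  refine ⟨c 0, c (-(π / 2)), fun a b hab => ?_, fun A _ => ?_, ?_⟩
  · simp only [Tijs_eq_phaseMoment, Tijc_eq_phaseMoment]
    exact ⟨hlim _ a b hab, hlim _ a b hab⟩
  · obtain ⟨C, hC, hbound⟩ := exists_abs_phaseMoment_rpow_sub_le hg hij hε.2 A
    simp only [Tijs_eq_phaseMoment, Tijc_eq_phaseMoment]
    refine ⟨C, hC, fun a b hab => ⟨fun N₁ N₂ h1 h12 =>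
      ⟨hbound a b _ N₁ N₂ hab h1 h12, hbound a b _ N₁ N₂ hab h1 h12⟩, fun N hN => ?_⟩⟩
    have hle : C * N ^ (-A) ≤ 2 * C * N ^ (-A) :=
      mul_le_mul_of_nonneg_right (by linarith) (Real.rpow_nonneg (by linarith) _)
    exact ⟨(hrate hbound _ a b N hab hN).trans hle, (hrate hbound _ a b N hab hN).trans hle⟩
  · obtain ⟨C, hC, hbound⟩ := exists_abs_phaseMoment_rpow_sub_le hg hij hε.2 1
    have hunif (θ a b : ℝ) (hab : a ^ 2 + b ^ 2 = 1) : |c θ a b| ≤ C +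
        ∫ h, (Metric.closedBall 0 1⁻¹).indicator (fun h => 1 * |momentKernel i j h|) h := by
      have h1 := hrate hbound θ a b 1 hab le_rfl
      rw [Real.one_rpow, Real.one_rpow, mul_one] at h1
      have h2 := abs_phaseMoment_le (i := i) (j := j) hg one_pos a b θ
      have h3 := abs_sub_abs_le_abs_sub (c θ a b) (phaseMoment g i j a b θ 1)
      linarith
    refine ⟨_, add_pos_of_pos_of_nonneg hC (integral_nonneg fun h => ?_), fun a b hab =>
      ⟨hunif _ a b hab, hunif _ a b hab⟩⟩
    exact Set.indicator_nonneg (fun h _ => mul_nonneg zero_le_one (abs_nonneg _)) h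
end
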